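/- arXiv:1602.08231 — 3 statements merged into one kernel-verified Lean document; each statement's English description precedes it below -/
import Mathlib

section
/- Let m ≥ 1, let κ be a positive integer, and let s₁, s₂ ∈ ℂ satisfy Re(2s₂ + κ) > 2m and Re((2/m)s₁ + 2s₂ + κ) > 2m. Then for every z ∈ ℌ_m and any set R of representatives of the cosets Γ_∞\Γ, the Poincaré series of exponential type 𝒫_τ(z,s₁,s₂) = ∑_{γ ∈ R} exp(2πi·tr(τ(γ·z))) · tr(τ·Im(γ·z))^{s₁} · det(Im(γ·z))^{s₂} · det(c_γ z + d_γ)^{−κ} converges absolutely, uniformly for (s₁,s₂) in compact subsets of this region. In particular, for m = 2 and κ = 4, in the coordinates s₁ = (v−2u−1)/2 and s₂ = (u−2)/2, the series converges absolutely on the cone A = {(u,v) ∈ ℂ² : Re u > 2 and Re v > 5}. -/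
open Matrix MeasureTheory Filter Topology

noncomputable section

/-- The matrix `W = [[0,−E_m],[E_m,0]]` of the standard symplectic form. -/
def Wmat (m : ℕ) : Matrix (Fin m ⊕ Fin m) (Fin m ⊕ Fin m) ℝ :=
  Matrix.fromBlocks 0 (-1) 1 0

/-- `g ∈ Sp_m(ℝ)`, i.e. `gᵀ W g = W`. -/
def IsSymplectic {m : ℕ} (g : Matrix (Fin m ⊕ Fin m) (Fin m ⊕ Fin m) ℝ) : Prop :=
  gᵀ * Wmat m * g = Wmat m

/-- All entries of `g` are integers. -/
def IsIntegralMat {m : ℕ} (g : Matrix (Fin m ⊕ Fin m) (Fin m ⊕ Fin m) ℝ) : Prop :=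
  ∀ i j, ∃ n : ℤ, g i j = (n : ℝ)

/-- Imaginary part of a complex matrix, as a real matrix. -/
def imPart {m : ℕ} (z : Matrix (Fin m) (Fin m) ℂ) : Matrix (Fin m) (Fin m) ℝ :=
  Matrix.of fun i j => (z i j).im

/-- Real part of a complex matrix, as a real matrix. -/
def rePart {m : ℕ} (z : Matrix (Fin m) (Fin m) ℂ) : Matrix (Fin m) (Fin m) ℝ :=
  Matrix.of fun i j => (z i j).re

/-- The Siegel upper half space `ℌ_m` of genus `m`. -/
def SiegelUHS (m : ℕ) : Set (Matrix (Fin m) (Fin m) ℂ) :=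
  {z | z.IsSymm ∧ (imPart z).PosDef}

/-- A real matrix viewed as a complex matrix. -/
def cmat {m : ℕ} (A : Matrix (Fin m) (Fin m) ℝ) : Matrix (Fin m) (Fin m) ℂ :=
  A.map Complex.ofReal

/-- The action `g·z = (az+b)(cz+d)⁻¹` of `Sp_m(ℝ)` on `ℌ_m`. -/
def act {m : ℕ} (g : Matrix (Fin m ⊕ Fin m) (Fin m ⊕ Fin m) ℝ)
    (z : Matrix (Fin m) (Fin m) ℂ) : Matrix (Fin m) (Fin m) ℂ :=
  (cmat (Matrix.toBlocks₁₁ g) * z + cmat (Matrix.toBlocks₁₂ g)) *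
    (cmat (Matrix.toBlocks₂₁ g) * z + cmat (Matrix.toBlocks₂₂ g))⁻¹

/-- The factor of automorphy `j(g,z) = det(cz + d)`. -/
def autFactor {m : ℕ} (g : Matrix (Fin m ⊕ Fin m) (Fin m ⊕ Fin m) ℝ)
    (z : Matrix (Fin m) (Fin m) ℂ) : ℂ :=
  (cmat (Matrix.toBlocks₂₁ g) * z + cmat (Matrix.toBlocks₂₂ g)).det

/-- The group of translations
`Γ_∞ = {[[±E_m, S],[0, ±E_m]] : S integral symmetric}`. -/
def GammaInf (m : ℕ) : Set (Matrix (Fin m ⊕ Fin m) (Fin m ⊕ Fin m) ℝ) :=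
  {g | ∃ (ε : ℝ) (S : Matrix (Fin m) (Fin m) ℝ), (ε = 1 ∨ ε = -1) ∧
      (∀ i j, ∃ n : ℤ, S i j = (n : ℝ)) ∧ S.IsSymm ∧
      g = Matrix.fromBlocks (ε • 1) S 0 (ε • 1)}

/-- `Γ` is a subgroup of finite index in `Sp_m(ℤ)` containing `Γ_∞`. -/
structure IsModularSubgroup (m : ℕ)
    (Γ : Set (Matrix (Fin m ⊕ Fin m) (Fin m ⊕ Fin m) ℝ)) : Prop where
  symplectic : ∀ γ ∈ Γ, IsSymplectic γ
  integral : ∀ γ ∈ Γ, IsIntegralMat γ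
  one_mem : (1 : Matrix (Fin m ⊕ Fin m) (Fin m ⊕ Fin m) ℝ) ∈ Γ
  mul_mem : ∀ γ ∈ Γ, ∀ δ ∈ Γ, γ * δ ∈ Γ
  inv_mem : ∀ γ ∈ Γ, γ⁻¹ ∈ Γ
  gammaInf_subset : GammaInf m ⊆ Γ
  finiteIndex : ∃ T : Finset (Matrix (Fin m ⊕ Fin m) (Fin m ⊕ Fin m) ℝ),
      ∀ g, IsSymplectic g → IsIntegralMat g → ∃ t ∈ T, ∃ γ ∈ Γ, g = γ * t

/-- `R` is a set of representatives of the cosets `Γ_∞\Γ`. -/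
def IsReps (m : ℕ) (Γ R : Set (Matrix (Fin m ⊕ Fin m) (Fin m ⊕ Fin m) ℝ)) : Prop :=
  R ⊆ Γ ∧ ∀ γ ∈ Γ, ∃! ρ, ρ ∈ R ∧ ∃ δ ∈ GammaInf m, γ = δ * ρ

/-- `τ` is half-integral: integral diagonal entries and off-diagonal entries in `½ℤ`. -/
def HalfIntegral {m : ℕ} (τ : Matrix (Fin m) (Fin m) ℝ) : Prop :=
  (∀ i, ∃ n : ℤ, τ i i = (n : ℝ)) ∧ ∀ i j, i ≠ j → ∃ n : ℤ, τ i j = (n : ℝ) / 2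

/-- The summand of the Poincaré series of exponential type of weight `κ`:
`exp(2πi tr(τ(γ·z))) · tr(τ·Im(γ·z))^{s₁} · det(Im(γ·z))^{s₂} · det(c_γ z + d_γ)^{−κ}`. -/
def term1 {m : ℕ} (τ : Matrix (Fin m) (Fin m) ℝ) (κ : ℕ) (s₁ s₂ : ℂ)
    (γ : Matrix (Fin m ⊕ Fin m) (Fin m ⊕ Fin m) ℝ) (z : Matrix (Fin m) (Fin m) ℂ) : ℂ :=
  Complex.exp (2 * (Real.pi : ℂ) * Complex.I * (cmat τ * act γ z).trace) *
    (((τ * imPart (act γ z)).trace : ℝ) : ℂ) ^ s₁ *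
    (((imPart (act γ z)).det : ℝ) : ℂ) ^ s₂ *
    autFactor γ z ^ (-(κ : ℤ))

/-- The region `Re(2s₂ + κ) > 2m` and `Re((2/m)s₁ + 2s₂ + κ) > 2m`. -/
def Region1 (m : ℕ) (κ : ℕ) : Set (ℂ × ℂ) :=
  {p | 2 * (m : ℝ) < (2 * p.2 + (κ : ℂ)).re ∧
    2 * (m : ℝ) < ((2 / (m : ℂ)) * p.1 + 2 * p.2 + (κ : ℂ)).re}

/-- Cholesky decomposition of a real positive definite matrix. -/
lemma exists_cholesky {m : ℕ} {Y : Matrix (Fin m) (Fin m) ℝ} (hY : Y.PosDef) :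
    ∃ A : Matrix (Fin m) (Fin m) ℝ,
      (∀ i j, i < j → A i j = 0) ∧ (∀ i, 0 < A i i) ∧ A * Aᵀ = Y := by
  have hlow : ∀ i j, i < j → LDL.lower hY i j = 0 := by
    have h1 : (LDL.lowerInv hY).BlockTriangular OrderDual.toDual :=
      fun i j hij => LDL.lowerInv_triangular hY hij
    have h2 := Matrix.blockTriangular_inv_of_blockTriangular h1
    exact fun i j hij => h2 hij
  have hd : ∀ i, 0 ≤ LDL.diagEntries hY i := by
    have h := hY.posSemidef.mul_mul_conjTranspose_same (LDL.lowerInv hY)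
    rw [← LDL.diag_eq_lowerInv_conj hY, LDL.diag, Matrix.posSemidef_diagonal_iff] at h
    exact h
  set A₀ : Matrix (Fin m) (Fin m) ℝ :=
    LDL.lower hY * Matrix.diagonal (fun i => √(LDL.diagEntries hY i)) with hA₀
  have hA₀Y : A₀ * A₀ᵀ = Y := by
    conv_rhs => rw [← LDL.lower_conj_diag hY]
    rw [hA₀, Matrix.transpose_mul, Matrix.diagonal_transpose, ← Matrix.mul_assoc,
      Matrix.mul_assoc (LDL.lower hY), Matrix.diagonal_mul_diagonal, LDL.diag,
      Matrix.conjTranspose_eq_transpose_of_trivial]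
    congr 3
    ext i
    exact Real.mul_self_sqrt (hd i)
  have hA₀low : ∀ i j, i < j → A₀ i j = 0 := by
    intro i j hij
    simp [hA₀, Matrix.mul_diagonal, hlow i j hij]
  have hA₀diag : ∀ i, A₀ i i ≠ 0 := by
    have h1 : A₀.det * A₀.det ≠ 0 := by
      have := congrArg Matrix.det hA₀Y
      rw [Matrix.det_mul, Matrix.det_transpose] at this
      rw [this]
      exact hY.det_pos.ne'
    have h2 : A₀.det = ∏ i, A₀ i i :=
      Matrix.det_of_isLowerTriangular A₀ (fun i j hij => hA₀low i j hij)
    have h3 : ∏ i, A₀ i i ≠ 0 := h2 ▸ left_ne_zero_of_mul h1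
    exact fun i => Finset.prod_ne_zero_iff.mp h3 i (Finset.mem_univ i)
  refine ⟨A₀ * Matrix.diagonal (fun i => SignType.sign (A₀ i i) : Fin m → ℝ), ?_, ?_, ?_⟩
  · intro i j hij
    simp [Matrix.mul_diagonal, hA₀low i j hij]
  · intro i
    rw [Matrix.mul_diagonal, self_mul_sign]
    exact abs_pos.mpr (hA₀diag i)
  · rw [Matrix.transpose_mul, Matrix.diagonal_transpose, ← Matrix.mul_assoc,
      Matrix.mul_assoc A₀, Matrix.diagonal_mul_diagonal]
    have : (fun i => ((SignType.sign (A₀ i i) : SignType) : ℝ) * (SignType.sign (A₀ i i) : ℝ))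
        = fun _ => 1 := by
      funext i
      rcases lt_or_gt_of_ne (hA₀diag i) with h | h
      · simp [sign_neg h]
      · simp [sign_pos h]
    rw [this, Matrix.diagonal_one, Matrix.mul_one, hA₀Y]

/-- Reduction of a vector modulo the first `p` rows of a lower triangular matrix. -/
lemma exists_reduce_mod_rows {m : ℕ} {B : Matrix (Fin m) (Fin m) ℝ}
    (hlow : ∀ i j, i < j → B i j = 0) (hpos : ∀ i, 0 < B i i) (p : ℕ) (v : Fin m → ℝ) :
    ∃ n : Fin m → ℤ, (∀ l : Fin m, p ≤ (l : ℕ) → n l = 0) ∧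
      ∀ j : Fin m, (j : ℕ) < p → 0 ≤ v j + ∑ l, (n l : ℝ) * B l j ∧
        v j + ∑ l, (n l : ℝ) * B l j < B j j := by
  induction p generalizing v with
  | zero => exact ⟨0, by simp, by simp⟩
  | succ p ih =>
    by_cases hp : p < m
    · set i : Fin m := ⟨p, hp⟩
      set c : ℤ := -⌊v i / B i i⌋
      obtain ⟨n, hn0, hn⟩ := ih (fun j => v j + c * B i j)
      have hsum : ∀ j, v j + ∑ l, ((n + Pi.single i c : Fin m → ℤ) l : ℝ) * B l j
          = (v j + c * B i j) + ∑ l, (n l : ℝ) * B l j := by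
        intro j
        have : ∑ l, ((Pi.single i c : Fin m → ℤ) l : ℝ) * B l j = c * B i j := by
          rw [Finset.sum_eq_single i]
          · simp
          · intro b _ hb
            simp [hb]
          · simp
        simp only [Pi.add_apply, Int.cast_add, add_mul, Finset.sum_add_distrib, this]
        ring
      refine ⟨n + Pi.single i c, ?_, ?_⟩
      · intro l hl
        have hli : l ≠ i := by
          intro h
          rw [h] at hl
          simp [i] at hl
        simp [hn0 l (by omega), hli]
      · intro j hj
        rw [hsum]
        by_cases hjp : (j : ℕ) < p
        · exact hn j hjp
        · have hji : j = i := Fin.ext (by simp [i]; omega)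
          subst hji
          have : ∑ l, (n l : ℝ) * B l i = 0 := by
            refine Finset.sum_eq_zero fun l _ => ?_
            by_cases hl : p ≤ (l : ℕ)
            · simp [hn0 l hl]
            · rw [hlow l i (by rw [Fin.lt_def]; simp [i]; omega), mul_zero]
          rw [this, add_zero]
          have hB := hpos i
          have h1 := Int.floor_le (v i / B i i)
          have h2 := Int.lt_floor_add_one (v i / B i i)
          rw [le_div_iff₀ hB] at h1
          rw [div_lt_iff₀ hB] at h2
          constructor
          · simp only [c]; push_cast; linarith
          · simp only [c]; push_cast; linarith
    · obtain ⟨n, hn0, hn⟩ := ih v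
      refine ⟨n, fun l hl => hn0 l (by omega), fun j hj => hn j (by omega)⟩

/-- An entrywise bound for matrix products. -/
lemma norm_mul_apply_le {𝕜 ι κ' μ : Type*} [RCLike 𝕜] [Fintype κ'] {M : Matrix ι κ' 𝕜}
    {N : Matrix κ' μ 𝕜} {a b : ℝ} (ha : 0 ≤ a) (hM : ∀ i j, ‖M i j‖ ≤ a) (hN : ∀ i j, ‖N i j‖ ≤ b)
    (i : ι) (j : μ) : ‖(M * N) i j‖ ≤ Fintype.card κ' * (a * b) := by
  rw [Matrix.mul_apply]
  refine (norm_sum_le _ _).trans ?_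
  calc ∑ l, ‖M i l * N l j‖ ≤ ∑ _l : κ', a * b := by
        refine Finset.sum_le_sum fun l _ => ?_
        rw [norm_mul]
        exact mul_le_mul (hM i l) (hN l j) (norm_nonneg _) ha
    _ = _ := by simp

/-- The entries of the inverse of a matrix with determinant at least one. -/
lemma abs_inv_apply_le {m : ℕ} {u : Matrix (Fin m) (Fin m) ℝ} {x : ℝ} (hx : 1 ≤ x)
    (hu : ∀ i j, |u i j| ≤ x) (hdet : 1 ≤ u.det) (i j : Fin m) :
    |u⁻¹ i j| ≤ (m.factorial : ℝ) * x ^ m := by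
  have h1 : |u.adjugate i j| ≤ (m.factorial : ℝ) * x ^ m := by
    rw [Matrix.adjugate_apply]
    have := Matrix.det_le (A := u.updateRow j (Pi.single i 1)) (abv := AbsoluteValue.abs) (x := x)
      (by
        intro k l
        rw [Matrix.updateRow_apply]
        split_ifs
        · by_cases hl : l = i
          · subst hl; simpa using hx
          · simp [hl]; linarith
        · exact hu k l)
    simpa using this
  rw [Matrix.inv_def, Matrix.smul_apply, smul_eq_mul, abs_mul, Ring.inverse_eq_inv', abs_inv,
    abs_of_pos (by linarith : 0 < u.det)]
  calc u.det⁻¹ * |u.adjugate i j| ≤ 1 * |u.adjugate i j| := by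
        gcongr
        exact inv_le_one_of_one_le₀ hdet
    _ ≤ _ := by rw [one_mul]; exact h1
/-- The diagonal matrix with entries `2 ^ (-k i)`. -/
def dyadicDiag {m : ℕ} (k : Fin m → ℕ) : Matrix (Fin m) (Fin m) ℝ :=
  Matrix.diagonal fun i => (1 / 2 : ℝ) ^ k i

/-- An integer matrix viewed as a real matrix. -/
def rmat {m : ℕ} (N : Matrix (Fin m) (Fin m) ℤ) : Matrix (Fin m) (Fin m) ℝ :=
  N.map (Int.cast : ℤ → ℝ)

lemma rmat_mul {m : ℕ} (M N : Matrix (Fin m) (Fin m) ℤ) : rmat (M * N) = rmat M * rmat N :=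
  Matrix.map_mul (f := Int.castRingHom ℝ)

lemma rmat_one {m : ℕ} : rmat (1 : Matrix (Fin m) (Fin m) ℤ) = 1 :=
  Matrix.map_one _ Int.cast_zero Int.cast_one

lemma exists_dyadic_near {x r : ℝ} (hx : 0 < x) (hr : 1 ≤ r) (hxr : x ≤ r) :
    ∃ k : ℕ, (1 / 2 : ℝ) ^ k ≤ x ∧ x ≤ 2 * r * (1 / 2 : ℝ) ^ k := by
  by_cases h : x ≤ 1
  · obtain ⟨k, hk1, hk2⟩ := exists_nat_pow_near_of_lt_one hx h (y := (1 / 2 : ℝ))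
      (by norm_num) (by norm_num)
    refine ⟨k + 1, hk1.le, ?_⟩
    have h0 : (0 : ℝ) < (1 / 2 : ℝ) ^ k := by positivity
    rw [pow_succ]
    nlinarith
  · exact ⟨0, by simp; linarith, by simp; linarith⟩

lemma sq_apply_le_trace {m : ℕ} (A : Matrix (Fin m) (Fin m) ℝ) (i j : Fin m) :
    A i j ^ 2 ≤ (A * Aᵀ).trace := by
  have h1 : (A * Aᵀ).trace = ∑ i, ∑ j, A i j ^ 2 := by
    simp [Matrix.trace, Matrix.mul_apply, sq]
  rw [h1]
  calc A i j ^ 2 ≤ ∑ j, A i j ^ 2 :=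
        Finset.single_le_sum (f := fun j => A i j ^ 2) (fun _ _ => sq_nonneg _) (Finset.mem_univ j)
    _ ≤ _ := Finset.single_le_sum (f := fun i => ∑ j, A i j ^ 2)
        (fun _ _ => Finset.sum_nonneg fun _ _ => sq_nonneg _) (Finset.mem_univ i)

/-- The bound for the bounded factor in the reduced Cholesky decomposition. -/
def cellBound (m : ℕ) (r : ℝ) : ℝ := (m.factorial : ℝ) * (2 * r) ^ m

lemma le_cellBound {m : ℕ} (hm : m ≠ 0) {r : ℝ} (hr : 1 ≤ r) : 2 * r ≤ cellBound m r := by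
  have h1 : (1 : ℝ) ≤ m.factorial := by exact_mod_cast m.factorial_pos
  have h2 : 2 * r ≤ (2 * r) ^ m := le_self_pow₀ (by linarith) hm
  unfold cellBound
  nlinarith

/-- Cholesky decomposition of a positive definite matrix reduced by integral unipotent matrices and
dyadic diagonal matrices, with a bounded remaining factor. -/
lemma exists_reduced_cholesky {m : ℕ} {Y : Matrix (Fin m) (Fin m) ℝ} (hY : Y.PosDef) {r : ℝ}
    (hr : 1 ≤ r) (htr : Y.trace ≤ r) :
    ∃ (k : Fin m → ℕ) (N N' : Matrix (Fin m) (Fin m) ℤ) (u v : Matrix (Fin m) (Fin m) ℝ),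
      N * N' = 1 ∧ u * v = 1 ∧ (∀ i j, |u i j| ≤ cellBound m r) ∧
      (∀ i j, |v i j| ≤ cellBound m r) ∧
      Y = (dyadicDiag k * rmat N * u) * (dyadicDiag k * rmat N * u)ᵀ ∧
      (∀ i, N i i = 1) ∧ (∀ i j, |(N i j : ℝ)| ≤ 2 ^ k i * (m * (r * cellBound m r))) ∧
      Y.det ≤ ∏ i, (2 * r * (1 / 2 : ℝ) ^ k i) ^ 2 := by
  obtain ⟨A, hAlow, hApos, hAY⟩ := exists_cholesky hY
  have hAr : ∀ i j, |A i j| ≤ r := by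
    intro i j
    have h1 := sq_apply_le_trace A i j
    rw [hAY] at h1
    exact abs_le_of_sq_le_sq (by nlinarith) (by linarith)
  choose k hk1 hk2 using fun i => exists_dyadic_near (hApos i) hr ((le_abs_self _).trans (hAr i i))
  set B : Matrix (Fin m) (Fin m) ℝ := Matrix.of fun i j => 2 ^ k i * A i j with hB
  have hBA : dyadicDiag k * B = A := by
    ext i j
    simp only [dyadicDiag, Matrix.diagonal_mul, hB, Matrix.of_apply, ← mul_assoc, ← mul_pow]
    norm_num
  have hBlow : ∀ i j, i < j → B i j = 0 := fun i j hij => by simp [hB, hAlow i j hij]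
  have h2k : ∀ i, (2 : ℝ) ^ k i * (1 / 2) ^ k i = 1 := fun i => by
    rw [← mul_pow]; norm_num
  have hB1 : ∀ i, 1 ≤ B i i := fun i => by
    have := mul_le_mul_of_nonneg_left (hk1 i) (by positivity : (0 : ℝ) ≤ 2 ^ k i)
    rw [h2k] at this
    exact this
  have hB2 : ∀ i, B i i ≤ 2 * r := fun i => by
    have := mul_le_mul_of_nonneg_left (hk2 i) (by positivity : (0 : ℝ) ≤ 2 ^ k i)
    rw [mul_left_comm, h2k, mul_one] at this
    exact this
  choose n hn0 hn using fun i : Fin m =>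
    exists_reduce_mod_rows hBlow (fun i => by linarith [hB1 i]) (i : ℕ) (B i)
  set N' : Matrix (Fin m) (Fin m) ℤ := Matrix.of n + 1 with hN'
  have hN'low : ∀ i j, i < j → N' i j = 0 := fun i j hij => by
    simp [hN', hn0 i j (by exact hij.le), Matrix.one_apply_ne hij.ne]
  have hN'diag : ∀ i, N' i i = 1 := fun i => by simp [hN', hn0 i i le_rfl]
  have hN'det : N'.det = 1 := by
    rw [Matrix.det_of_isLowerTriangular N' (fun i j hij => hN'low i j hij)]
    simp [hN'diag]
  have hu : ∀ i j, (rmat N' * B) i j = B i j + ∑ l, (n i l : ℝ) * B l j := by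
    intro i j
    have : rmat N' = (Matrix.of n).map (Int.cast : ℤ → ℝ) + 1 := by
      rw [hN', rmat, Matrix.map_add _ (fun a b => by push_cast; rfl)]
      congr 1
      exact rmat_one
    rw [this, Matrix.add_mul, Matrix.one_mul, Matrix.add_apply, add_comm]
    simp [Matrix.mul_apply]
  have hulow : ∀ i j, i < j → (rmat N' * B) i j = 0 := by
    intro i j hij
    rw [hu, hBlow i j hij, zero_add]
    refine Finset.sum_eq_zero fun l _ => ?_
    by_cases hl : (i : ℕ) ≤ l
    · simp [hn0 i l hl]
    · rw [hBlow l j (lt_trans (by rw [Fin.lt_def]; omega) hij), mul_zero]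
  have hudiag : ∀ i, (rmat N' * B) i i = B i i := by
    intro i
    rw [hu]
    have : ∑ l, (n i l : ℝ) * B l i = 0 := by
      refine Finset.sum_eq_zero fun l _ => ?_
      by_cases hl : (i : ℕ) ≤ l
      · simp [hn0 i l hl]
      · rw [hBlow l i (by rw [Fin.lt_def]; omega), mul_zero]
    rw [this, add_zero]
  have hu2r : ∀ i j, |(rmat N' * B) i j| ≤ 2 * r := by
    intro i j
    rcases lt_trichotomy i j with h | h | h
    · rw [hulow i j h, abs_zero]; linarith
    · subst h
      rw [hudiag, abs_of_pos (by linarith [hB1 i])]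
      exact hB2 i
    · have := hn i j h
      rw [← hu] at this
      rw [abs_of_nonneg this.1]
      linarith [hB2 j]
  have hudet : 1 ≤ (rmat N' * B).det := by
    rw [Matrix.det_of_isLowerTriangular _ (fun i j hij => hulow i j hij)]
    calc (1 : ℝ) = ∏ _i : Fin m, 1 := by simp
      _ ≤ _ := Finset.prod_le_prod (fun _ _ => zero_le_one) fun i _ => (hudiag i).symm ▸ hB1 i
  have hNN' : N'⁻¹ * N' = 1 := Matrix.nonsing_inv_mul _ (by simp [hN'det])
  have huv : (rmat N' * B) * (rmat N' * B)⁻¹ = 1 :=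
    Matrix.mul_nonsing_inv _ (by rw [isUnit_iff_ne_zero]; linarith)
  have hNu : rmat N'⁻¹ * (rmat N' * B) = B := by
    rw [← Matrix.mul_assoc, ← rmat_mul, hNN', rmat_one, Matrix.one_mul]
  have hNB : rmat N'⁻¹ = B * (rmat N' * B)⁻¹ := by
    calc rmat N'⁻¹ = rmat N'⁻¹ * ((rmat N' * B) * (rmat N' * B)⁻¹) := by rw [huv, Matrix.mul_one]
      _ = _ := by rw [← Matrix.mul_assoc, hNu]
  have hv := abs_inv_apply_le (by linarith : 1 ≤ 2 * r) hu2r hudet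
  have hNlow : ∀ i j, i < j → N'⁻¹ i j = 0 := by
    have : Invertible N' := Matrix.invertibleOfIsUnitDet _ (by simp [hN'det])
    have h1 : N'.BlockTriangular OrderDual.toDual := fun i j hij => hN'low i j hij
    have h2 := Matrix.blockTriangular_inv_of_blockTriangular h1
    exact fun i j hij => h2 hij
  refine ⟨k, N'⁻¹, N', rmat N' * B, (rmat N' * B)⁻¹, hNN', huv, ?_, hv, ?_, ?_, ?_, ?_⟩
  · intro i j
    exact (hu2r i j).trans (le_cellBound (by have := i.2; omega) hr)
  · rw [Matrix.mul_assoc (dyadicDiag k), hNu, hBA, hAY]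
  · intro i
    have h := congrFun (congrFun hNN' i) i
    rw [Matrix.mul_apply, Finset.sum_eq_single i, hN'diag, mul_one, Matrix.one_apply_eq] at h
    · exact h
    · intro l _ hl
      rcases lt_or_gt_of_ne hl with h | h
      · rw [hN'low l i h, mul_zero]
      · rw [hNlow i l h, zero_mul]
    · simp
  · intro i j
    have h1 : (N'⁻¹ i j : ℝ) = 2 ^ k i * (A * (rmat N' * B)⁻¹) i j := by
      have : (N'⁻¹ i j : ℝ) = rmat N'⁻¹ i j := rfl
      rw [this, hNB, Matrix.mul_apply, Matrix.mul_apply, Finset.mul_sum]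
      simp only [hB, Matrix.of_apply, mul_assoc]
    rw [h1, abs_mul, abs_of_pos (by positivity : (0 : ℝ) < 2 ^ k i)]
    gcongr
    have := norm_mul_apply_le (𝕜 := ℝ) (M := A) (N := (rmat N' * B)⁻¹) (zero_le_one.trans hr)
      hAr hv i j
    simpa [cellBound] using this
  · have : Y.det = ∏ i, A i i ^ 2 := by
      rw [← hAY, Matrix.det_mul, Matrix.det_transpose,
        Matrix.det_of_isLowerTriangular A (fun i j hij => hAlow i j hij), ← Finset.prod_mul_distrib]
      simp [sq]
    rw [this]
    refine Finset.prod_le_prod (fun i _ => sq_nonneg _) fun i _ => ?_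
    exact pow_le_pow_left₀ (hApos i).le (hk2 i) 2
lemma cmat_mul {m : ℕ} (A B : Matrix (Fin m) (Fin m) ℝ) : cmat (A * B) = cmat A * cmat B :=
  Matrix.map_mul (f := Complex.ofRealHom)

lemma cmat_add {m : ℕ} (A B : Matrix (Fin m) (Fin m) ℝ) : cmat (A + B) = cmat A + cmat B :=
  Matrix.map_add _ Complex.ofReal_add A B

lemma cmat_sub {m : ℕ} (A B : Matrix (Fin m) (Fin m) ℝ) : cmat (A - B) = cmat A - cmat B :=
  Matrix.map_sub _ Complex.ofReal_sub A B

lemma cmat_one {m : ℕ} : cmat (1 : Matrix (Fin m) (Fin m) ℝ) = 1 :=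
  Matrix.map_one _ Complex.ofReal_zero Complex.ofReal_one

lemma cmat_zero {m : ℕ} : cmat (0 : Matrix (Fin m) (Fin m) ℝ) = 0 :=
  Matrix.map_zero _ Complex.ofReal_zero

lemma cmat_transpose {m : ℕ} (A : Matrix (Fin m) (Fin m) ℝ) : cmat Aᵀ = (cmat A)ᵀ := rfl

lemma cmat_conjTranspose {m : ℕ} (A : Matrix (Fin m) (Fin m) ℝ) : (cmat A)ᴴ = (cmat A)ᵀ := by
  ext i j
  simp [cmat]

lemma det_cmat {m : ℕ} (A : Matrix (Fin m) (Fin m) ℝ) : (cmat A).det = (A.det : ℂ) :=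
  (RingHom.map_det Complex.ofRealHom A).symm

lemma rePart_add_imPart {m : ℕ} (z : Matrix (Fin m) (Fin m) ℂ) :
    cmat (rePart z) + Complex.I • cmat (imPart z) = z := by
  ext i j
  simp [cmat, rePart, imPart, mul_comm Complex.I, Complex.re_add_im]

/-- The numerator `az + b` of the action. -/
def actNum {m : ℕ} (g : Matrix (Fin m ⊕ Fin m) (Fin m ⊕ Fin m) ℝ)
    (z : Matrix (Fin m) (Fin m) ℂ) : Matrix (Fin m) (Fin m) ℂ :=
  cmat (Matrix.toBlocks₁₁ g) * z + cmat (Matrix.toBlocks₁₂ g)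

/-- The denominator `cz + d` of the action. -/
def actDen {m : ℕ} (g : Matrix (Fin m ⊕ Fin m) (Fin m ⊕ Fin m) ℝ)
    (z : Matrix (Fin m) (Fin m) ℂ) : Matrix (Fin m) (Fin m) ℂ :=
  cmat (Matrix.toBlocks₂₁ g) * z + cmat (Matrix.toBlocks₂₂ g)

section Symplectic

variable {m : ℕ} {g : Matrix (Fin m ⊕ Fin m) (Fin m ⊕ Fin m) ℝ}

lemma isSymplectic_fromBlocks_iff {a b c d : Matrix (Fin m) (Fin m) ℝ} :
    IsSymplectic (Matrix.fromBlocks a b c d) ↔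
      cᵀ * a - aᵀ * c = 0 ∧ cᵀ * b - aᵀ * d = -1 ∧ dᵀ * a - bᵀ * c = 1 ∧
        dᵀ * b - bᵀ * d = 0 := by
  simp [IsSymplectic, Wmat, Matrix.fromBlocks_transpose, Matrix.fromBlocks_multiply,
    Matrix.fromBlocks_inj, ← sub_eq_add_neg]

lemma IsSymplectic.actDen_pairing (hg : IsSymplectic g) (w z : Matrix (Fin m) (Fin m) ℂ) :
    (actDen g w)ᵀ * actNum g z - (actNum g w)ᵀ * actDen g z = z - wᵀ := by
  rw [← Matrix.fromBlocks_toBlocks g, isSymplectic_fromBlocks_iff] at hg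
  obtain ⟨h1, h2, h3, h4⟩ := hg
  simp only [actNum, actDen]
  set a := g.toBlocks₁₁
  set b := g.toBlocks₁₂
  set c := g.toBlocks₂₁
  set d := g.toBlocks₂₂
  replace h1 := congrArg cmat h1
  replace h2 := congrArg cmat h2
  replace h3 := congrArg cmat h3
  replace h4 := congrArg cmat h4
  simp only [cmat_sub, cmat_mul, cmat_transpose, cmat_zero, cmat_one] at h1 h2 h3 h4
  have h2' : cmat (-1 : Matrix (Fin m) (Fin m) ℝ) = -1 := by
    rw [← zero_sub, cmat_sub, cmat_zero, cmat_one, zero_sub]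
  rw [h2'] at h2
  simp only [Matrix.transpose_add, Matrix.transpose_mul]
  calc _ = wᵀ * ((cmat c)ᵀ * cmat a - (cmat a)ᵀ * cmat c) * z
        + wᵀ * ((cmat c)ᵀ * cmat b - (cmat a)ᵀ * cmat d)
        + ((cmat d)ᵀ * cmat a - (cmat b)ᵀ * cmat c) * z
        + ((cmat d)ᵀ * cmat b - (cmat b)ᵀ * cmat d) := by noncomm_ring
    _ = _ := by
      rw [h1, h2, h3, h4]
      simp [sub_eq_add_neg, add_comm]

lemma re_star_dotProduct_cmat_mulVec (y : Matrix (Fin m) (Fin m) ℝ)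
    (v : Fin m → ℂ) : (star v ⬝ᵥ (cmat y *ᵥ v)).re
      = (fun i => (v i).re) ⬝ᵥ (y *ᵥ fun i => (v i).re)
        + (fun i => (v i).im) ⬝ᵥ (y *ᵥ fun i => (v i).im) := by
  simp only [dotProduct, Matrix.mulVec, cmat, Matrix.map_apply, Pi.star_apply, Complex.re_sum,
    Complex.mul_re, Complex.mul_im, Complex.ofReal_re, Complex.ofReal_im,
    RCLike.star_def, Complex.conj_re, Complex.conj_im, Finset.mul_sum, ← Finset.sum_add_distrib]
  refine Finset.sum_congr rfl fun i _ => Finset.sum_congr rfl fun j _ => ?_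
  ring

lemma re_star_dotProduct_cmat_mulVec_pos {y : Matrix (Fin m) (Fin m) ℝ} (hy : y.PosDef)
    {v : Fin m → ℂ} (hv : v ≠ 0) : 0 < (star v ⬝ᵥ (cmat y *ᵥ v)).re := by
  rw [re_star_dotProduct_cmat_mulVec]
  have h1 := hy.posSemidef.dotProduct_mulVec_nonneg fun i => (v i).re
  have h2 := hy.posSemidef.dotProduct_mulVec_nonneg fun i => (v i).im
  simp only [star_trivial] at h1 h2
  by_cases hr : (fun i => (v i).re) = 0
  · have hi : (fun i => (v i).im) ≠ 0 := by
      intro hi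
      apply hv
      funext i
      exact Complex.ext (congrFun hr i) (congrFun hi i)
    have := hy.dotProduct_mulVec_pos hi
    simp only [star_trivial] at this
    linarith
  · have := hy.dotProduct_mulVec_pos hr
    simp only [star_trivial] at this
    linarith

variable {z : Matrix (Fin m) (Fin m) ℂ}

lemma sub_conjTranspose_of_isSymm (hz : z.IsSymm) :
    z - zᴴ = (2 * Complex.I) • cmat (imPart z) := by
  ext i j
  have hs : z j i = z i j := congrFun (congrFun hz i) j
  simp [cmat, imPart, hs, Complex.ext_iff]
  ring

lemma map_conj_actNum (g : Matrix (Fin m ⊕ Fin m) (Fin m ⊕ Fin m) ℝ) :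
    (actNum g (z.map star))ᵀ = (actNum g z)ᴴ := by
  ext i j
  simp [actNum, cmat, Matrix.mul_apply]

lemma map_conj_actDen (g : Matrix (Fin m ⊕ Fin m) (Fin m ⊕ Fin m) ℝ) :
    (actDen g (z.map star))ᵀ = (actDen g z)ᴴ := by
  ext i j
  simp [actDen, cmat, Matrix.mul_apply]

lemma IsSymplectic.actDen_pairing_conj (hg : IsSymplectic g) (hz : z ∈ SiegelUHS m) :
    (actDen g z)ᴴ * actNum g z - (actNum g z)ᴴ * actDen g z
      = (2 * Complex.I) • cmat (imPart z) := by
  rw [← map_conj_actNum, ← map_conj_actDen, hg.actDen_pairing, ← sub_conjTranspose_of_isSymm hz.1]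
  rfl

lemma IsSymplectic.isUnit_det_actDen (hg : IsSymplectic g) (hz : z ∈ SiegelUHS m) :
    IsUnit (actDen g z).det := by
  rw [isUnit_iff_ne_zero]
  intro h0
  obtain ⟨v, hv, hv0⟩ := Matrix.exists_mulVec_eq_zero_iff.mpr h0
  have h := congrArg (fun M => star v ⬝ᵥ (M *ᵥ v)) (hg.actDen_pairing_conj hz)
  have hv1 : star v ᵥ* (actDen g z)ᴴ = 0 := by
    rw [← Matrix.star_mulVec, hv0, star_zero]
  simp only [Matrix.sub_mulVec, ← Matrix.mulVec_mulVec, hv0, Matrix.mulVec_zero, sub_zero,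
    Matrix.smul_mulVec, dotProduct_smul] at h
  rw [Matrix.dotProduct_mulVec, hv1, zero_dotProduct] at h
  refine (re_star_dotProduct_cmat_mulVec_pos hz.2 hv).ne' ?_
  have h' : star v ⬝ᵥ (cmat (imPart z) *ᵥ v) = 0 := by simpa using h.symm
  rw [h', Complex.zero_re]

lemma IsSymplectic.act_mul_actDen (hg : IsSymplectic g) (hz : z ∈ SiegelUHS m) :
    act g z * actDen g z = actNum g z := by
  have : act g z = actNum g z * (actDen g z)⁻¹ := rfl
  rw [this, Matrix.mul_assoc, Matrix.nonsing_inv_mul _ (hg.isUnit_det_actDen hz), Matrix.mul_one]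

lemma IsSymplectic.act_isSymm (hg : IsSymplectic g) (hz : z ∈ SiegelUHS m) :
    (act g z).IsSymm := by
  have hu : IsUnit (actDen g z) := (Matrix.isUnit_iff_isUnit_det _).mpr (hg.isUnit_det_actDen hz)
  have hu' : IsUnit (actDen g z)ᵀ := by
    rw [Matrix.isUnit_iff_isUnit_det, Matrix.det_transpose]
    exact hg.isUnit_det_actDen hz
  have h := hg.actDen_pairing z z
  rw [hz.1.eq, sub_self, sub_eq_zero, ← hg.act_mul_actDen hz, Matrix.transpose_mul,
    ← Matrix.mul_assoc] at h
  exact (hu'.mul_left_cancel (hu.mul_right_cancel h)).symm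

lemma IsSymplectic.imPart_act (hg : IsSymplectic g) (hz : z ∈ SiegelUHS m) :
    (actDen g z)ᴴ * cmat (imPart (act g z)) * actDen g z = cmat (imPart z) := by
  have h := hg.actDen_pairing_conj hz
  have h2 : (actDen g z)ᴴ * (act g z - (act g z)ᴴ) * actDen g z
      = (2 * Complex.I) • cmat (imPart z) := by
    rw [← h, ← hg.act_mul_actDen hz, Matrix.conjTranspose_mul]
    noncomm_ring
  rw [sub_conjTranspose_of_isSymm (hg.act_isSymm hz), Matrix.mul_smul, Matrix.smul_mul] at h2
  exact smul_right_injective _ (by simp : (2 * Complex.I) ≠ 0) h2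

lemma imPart_isHermitian (hz : z.IsSymm) : (imPart z).IsHermitian := by
  ext i j
  have hs : z j i = z i j := congrFun (congrFun hz i) j
  simp [imPart, hs]

lemma IsSymplectic.imPart_act_posDef (hg : IsSymplectic g) (hz : z ∈ SiegelUHS m) :
    (imPart (act g z)).PosDef := by
  refine Matrix.PosDef.of_dotProduct_mulVec_pos (imPart_isHermitian (hg.act_isSymm hz)) ?_
  intro v hv
  set w : Fin m → ℂ := (actDen g z)⁻¹ *ᵥ fun i => (v i : ℂ)
  have hw : actDen g z *ᵥ w = fun i => (v i : ℂ) := by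
    rw [Matrix.mulVec_mulVec, Matrix.mul_nonsing_inv _ (hg.isUnit_det_actDen hz),
      Matrix.one_mulVec]
  have hw0 : w ≠ 0 := by
    rintro h0
    rw [h0, Matrix.mulVec_zero] at hw
    exact hv (funext fun i => by simpa using (congrFun hw i).symm)
  have h := re_star_dotProduct_cmat_mulVec_pos hz.2 hw0
  rw [← hg.imPart_act hz, ← Matrix.mulVec_mulVec, ← Matrix.mulVec_mulVec, hw,
    Matrix.dotProduct_mulVec, ← Matrix.star_mulVec, hw, re_star_dotProduct_cmat_mulVec] at h
  simpa using h

lemma IsSymplectic.det_imPart_act (hg : IsSymplectic g) (hz : z ∈ SiegelUHS m) :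
    ‖autFactor g z‖ ^ 2 * (imPart (act g z)).det = (imPart z).det := by
  have h := congrArg Matrix.det (hg.imPart_act hz)
  rw [Matrix.det_mul, Matrix.det_mul, det_cmat, det_cmat, Matrix.det_conjTranspose] at h
  have h2 : star (actDen g z).det * (actDen g z).det = ((‖autFactor g z‖ ^ 2 : ℝ) : ℂ) := by
    rw [← Complex.normSq_eq_norm_sq, Complex.normSq_eq_conj_mul_self]
    rfl
  rw [mul_right_comm, h2] at h
  exact_mod_cast h

end Symplectic
/-- The translation `[[E_m, S],[0, E_m]]`. -/
def transl {m : ℕ} (S : Matrix (Fin m) (Fin m) ℝ) : Matrix (Fin m ⊕ Fin m) (Fin m ⊕ Fin m) ℝ :=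
  Matrix.fromBlocks 1 S 0 1

/-- The inverse of the symplectic matrix `[[A, X A⁻ᵀ],[0, A⁻ᵀ]]`. -/
def cellInv {m : ℕ} (A X : Matrix (Fin m) (Fin m) ℝ) :
    Matrix (Fin m ⊕ Fin m) (Fin m ⊕ Fin m) ℝ :=
  Matrix.fromBlocks A⁻¹ (-(A⁻¹ * X)) 0 Aᵀ

lemma isSymplectic_transl {m : ℕ} {S : Matrix (Fin m) (Fin m) ℝ} (hS : S.IsSymm) :
    IsSymplectic (transl S) := by
  rw [transl, isSymplectic_fromBlocks_iff]
  simp [hS.eq]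

lemma isSymplectic_cellInv {m : ℕ} {A X : Matrix (Fin m) (Fin m) ℝ} (hA : IsUnit A.det)
    (hX : X.IsSymm) : IsSymplectic (cellInv A X) := by
  rw [cellInv, isSymplectic_fromBlocks_iff]
  have h1 : A * A⁻¹ = 1 := Matrix.mul_nonsing_inv _ hA
  have h2 : A⁻¹ᵀ * Aᵀ = 1 := by rw [← Matrix.transpose_mul, h1, Matrix.transpose_one]
  refine ⟨by simp, by simp [h2], by simp [h1], ?_⟩
  rw [Matrix.transpose_neg, Matrix.transpose_mul, Matrix.transpose_transpose, Matrix.mul_neg,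
    ← Matrix.mul_assoc, h1, Matrix.neg_mul, Matrix.mul_assoc, h2, hX.eq]
  simp

lemma IsSymplectic.mul {m : ℕ} {g h : Matrix (Fin m ⊕ Fin m) (Fin m ⊕ Fin m) ℝ}
    (hg : IsSymplectic g) (hh : IsSymplectic h) : IsSymplectic (g * h) := by
  unfold IsSymplectic at *
  rw [Matrix.transpose_mul]
  calc hᵀ * gᵀ * Wmat m * (g * h) = hᵀ * (gᵀ * Wmat m * g) * h := by
        simp only [Matrix.mul_assoc]
    _ = _ := by rw [hg, hh]

section Cocycle

variable {m : ℕ} (g h : Matrix (Fin m ⊕ Fin m) (Fin m ⊕ Fin m) ℝ) (z : Matrix (Fin m) (Fin m) ℂ)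

lemma actNum_mul : actNum (g * h) z
    = cmat g.toBlocks₁₁ * actNum h z + cmat g.toBlocks₁₂ * actDen h z := by
  conv_lhs => rw [← Matrix.fromBlocks_toBlocks g, ← Matrix.fromBlocks_toBlocks h,
    Matrix.fromBlocks_multiply]
  simp only [actNum, actDen, Matrix.toBlocks_fromBlocks₁₁, Matrix.toBlocks_fromBlocks₁₂, cmat_add,
    cmat_mul]
  noncomm_ring

lemma actDen_mul : actDen (g * h) z
    = cmat g.toBlocks₂₁ * actNum h z + cmat g.toBlocks₂₂ * actDen h z := by
  conv_lhs => rw [← Matrix.fromBlocks_toBlocks g, ← Matrix.fromBlocks_toBlocks h,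
    Matrix.fromBlocks_multiply]
  simp only [actNum, actDen, Matrix.toBlocks_fromBlocks₂₁, Matrix.toBlocks_fromBlocks₂₂, cmat_add,
    cmat_mul]
  noncomm_ring

lemma actNum_transl_mul (S : Matrix (Fin m) (Fin m) ℝ) :
    actNum (transl S * g) z = actNum g z + cmat S * actDen g z := by
  simp [actNum_mul, transl, cmat_one]

lemma actDen_transl_mul (S : Matrix (Fin m) (Fin m) ℝ) :
    actDen (transl S * g) z = actDen g z := by
  simp [actDen_mul, transl, cmat_one, cmat_zero]

end Cocycle

lemma exists_norm_apply_le {𝕜 ι κ' : Type*} [RCLike 𝕜] [Fintype ι] [Fintype κ']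
    (M : Matrix ι κ' 𝕜) : ∃ b : ℝ, 0 ≤ b ∧ ∀ i j, ‖M i j‖ ≤ b := by
  refine ⟨∑ i, ∑ j, ‖M i j‖, by positivity, fun i j => ?_⟩
  calc ‖M i j‖ ≤ ∑ j, ‖M i j‖ :=
        Finset.single_le_sum (f := fun j => ‖M i j‖) (fun _ _ => norm_nonneg _) (Finset.mem_univ j)
    _ ≤ _ := Finset.single_le_sum (f := fun i => ∑ j, ‖M i j‖)
        (fun _ _ => Finset.sum_nonneg fun _ _ => norm_nonneg _) (Finset.mem_univ i)

/-- Real matrices `P`, `Q` are controlled by the complex matrix `Pz + Q`. -/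
lemma exists_bound_of_norm_mul_add_le {m : ℕ} {z : Matrix (Fin m) (Fin m) ℂ}
    (hz : z ∈ SiegelUHS m) : ∃ C : ℝ, 0 ≤ C ∧ ∀ (P Q : Matrix (Fin m) (Fin m) ℝ) (c : ℝ), 0 ≤ c →
      (∀ i j, ‖(cmat P * z + cmat Q) i j‖ ≤ c) →
      (∀ i j, |P i j| ≤ C * c) ∧ ∀ i j, |Q i j| ≤ C * c := by
  obtain ⟨b, hb0, hb⟩ := exists_norm_apply_le (imPart z)⁻¹
  obtain ⟨x, hx0, hx⟩ := exists_norm_apply_le (rePart z)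
  refine ⟨m * b + (1 + m * (m * b * x)), by positivity, fun P Q c hc h => ?_⟩
  have him : ∀ i j, (P * imPart z) i j = ((cmat P * z + cmat Q) i j).im := by
    intro i j
    simp [Matrix.mul_apply, cmat, imPart]
  have hre : ∀ i j, (P * rePart z) i j + Q i j = ((cmat P * z + cmat Q) i j).re := by
    intro i j
    simp [Matrix.mul_apply, cmat, rePart]
  have hP : ∀ i j, ‖P i j‖ ≤ m * (c * b) := by
    intro i j
    have h1 : P = (P * imPart z) * (imPart z)⁻¹ := by
      rw [Matrix.mul_assoc, Matrix.mul_nonsing_inv _ (isUnit_iff_ne_zero.mpr hz.2.det_pos.ne'),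
        Matrix.mul_one]
    rw [h1]
    have := norm_mul_apply_le (M := P * imPart z) (N := (imPart z)⁻¹) hc
      (fun i j => by rw [him]; exact (Complex.abs_im_le_norm _).trans (h i j)) hb i j
    simpa using this
  refine ⟨fun i j => (hP i j).trans ?_, fun i j => ?_⟩
  · have : 0 ≤ (1 + m * (m * b * x)) * c := by positivity
    linarith
  · have h1 := norm_mul_apply_le (M := P) (N := rePart z) (by positivity) hP hx i j
    have h2 := (Complex.abs_re_le_norm _).trans (h i j)
    rw [← hre] at h2
    rw [Real.norm_eq_abs, Fintype.card_fin] at h1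
    have h3 : |Q i j| ≤ |(P * rePart z) i j + Q i j| + |(P * rePart z) i j| := by
      have := abs_sub ((P * rePart z) i j + Q i j) ((P * rePart z) i j)
      simpa using this
    have : 0 ≤ (m * b) * c := by positivity
    linarith

lemma norm_apply_le_of_conjTranspose_mul_self {m : ℕ} {y : Matrix (Fin m) (Fin m) ℝ}
    (hy : y.PosDef) {M : Matrix (Fin m) (Fin m) ℂ} (hM : Mᴴ * M = cmat y) (i j : Fin m) :
    ‖M i j‖ ≤ 1 + y.trace := by
  have h1 := congrFun (congrFun hM j) j
  have h2 : ∑ l, ‖M l j‖ ^ 2 = y j j := by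
    have : ((∑ l, ‖M l j‖ ^ 2 : ℝ) : ℂ) = (y j j : ℂ) := by
      rw [← show cmat y j j = (y j j : ℂ) from rfl, ← h1, Matrix.mul_apply]
      push_cast
      refine Finset.sum_congr rfl fun l _ => ?_
      rw [Matrix.conjTranspose_apply, RCLike.star_def, ← Complex.normSq_eq_conj_mul_self,
        Complex.normSq_eq_norm_sq]
      push_cast
      rfl
    exact_mod_cast this
  have h3 : ‖M i j‖ ^ 2 ≤ y j j := by
    rw [← h2]
    exact Finset.single_le_sum (f := fun l => ‖M l j‖ ^ 2) (fun _ _ => sq_nonneg _)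
      (Finset.mem_univ i)
  have h4 : y j j ≤ y.trace := Finset.single_le_sum (f := fun l => y l l)
    (fun _ _ => hy.posSemidef.diag_nonneg) (Finset.mem_univ j)
  nlinarith [norm_nonneg (M i j)]

/-- An element `g` whose image point `g·z` is close to the base point of a cell differs from the
corresponding symplectic matrix by a bounded factor. -/
lemma exists_bound_cellInv_mul {m : ℕ} {z : Matrix (Fin m) (Fin m) ℂ} (hz : z ∈ SiegelUHS m) :
    ∃ C : ℝ, 0 ≤ C ∧ ∀ (g : Matrix (Fin m ⊕ Fin m) (Fin m ⊕ Fin m) ℝ)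
      (A X S t u v : Matrix (Fin m) (Fin m) ℝ) (a : ℝ), IsSymplectic g → IsUnit A.det → u * v = 1 →
      0 ≤ a → (∀ i j, |u i j| ≤ a) → (∀ i j, |v i j| ≤ a) → (∀ i j, |t i j| ≤ 1) →
      rePart (act g z) + S = X + A * t * Aᵀ → imPart (act g z) = (A * u) * (A * u)ᵀ →
      ∀ i j, |(cellInv A X * (transl S * g)) i j| ≤ C * a := by
  obtain ⟨C, hC0, hC⟩ := exists_bound_of_norm_mul_add_le hz
  have hK : 0 ≤ 1 + (imPart z).trace := by
    have : 0 ≤ (imPart z).trace := Finset.sum_nonneg fun i _ => hz.2.posSemidef.diag_nonneg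
    linarith
  set K := 1 + (imPart z).trace
  refine ⟨C * (m * (m * K) + m * K), by positivity, ?_⟩
  intro g A X S t u v a hg hA huv ha hu hv ht hX hY
  set J := actDen g z
  set M := cmat (A * u)ᵀ * J with hMdef
  have hM : Mᴴ * M = cmat (imPart z) := by
    rw [← hg.imPart_act hz, hY, hMdef, Matrix.conjTranspose_mul, cmat_conjTranspose,
      cmat_transpose, Matrix.transpose_transpose, cmat_mul (A * u) (A * u)ᵀ, cmat_transpose]
    simp only [Matrix.mul_assoc]
    rfl
  have hMK := norm_apply_le_of_conjTranspose_mul_self hz.2 hM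
  have hvu : vᵀ * uᵀ = 1 := by rw [← Matrix.transpose_mul, huv, Matrix.transpose_one]
  have hAJ : cmat Aᵀ * J = cmat vᵀ * M := by
    rw [hMdef, Matrix.transpose_mul, ← Matrix.mul_assoc, ← cmat_mul, ← Matrix.mul_assoc, hvu,
      Matrix.one_mul]
  have hcm : ∀ {w : Matrix (Fin m) (Fin m) ℝ} {b : ℝ}, (∀ i j, |w i j| ≤ b) →
      ∀ i j, ‖cmat w i j‖ ≤ b := by
    intro w b hw i j
    simpa [cmat] using hw i j
  have hbot : ∀ i j, ‖(cmat Aᵀ * J) i j‖ ≤ m * (a * K) := by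
    intro i j
    rw [hAJ]
    have := norm_mul_apply_le ha (hcm (w := vᵀ) fun i j => hv j i) hMK i j
    rwa [Fintype.card_fin] at this
  have hAA : A⁻¹ * A = 1 := Matrix.nonsing_inv_mul _ hA
  have htop : cmat A⁻¹ * (actNum g z + cmat S * J) - cmat (A⁻¹ * X) * J
      = cmat t * (cmat Aᵀ * J) + Complex.I • (cmat u * M) := by
    have h1 : actNum g z + cmat S * J = (cmat X + cmat (A * t * Aᵀ)
        + Complex.I • cmat ((A * u) * (A * u)ᵀ)) * J := by
      rw [← hg.act_mul_actDen hz, ← Matrix.add_mul, ← cmat_add, ← hX, ← hY, cmat_add]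
      conv_lhs => rw [← rePart_add_imPart (act g z)]
      congr 1
      abel
    rw [h1, Matrix.add_mul, Matrix.add_mul, Matrix.mul_add, Matrix.mul_add, Matrix.smul_mul,
      Matrix.mul_smul]
    simp only [← Matrix.mul_assoc, ← cmat_mul, hMdef, hAA, Matrix.one_mul]
    abel
  have hbd : ∀ i j, ‖(cmat A⁻¹ * (actNum g z + cmat S * J) - cmat (A⁻¹ * X) * J) i j‖
      ≤ m * (m * (a * K)) + m * (a * K) := by
    intro i j
    rw [htop, Matrix.add_apply, Matrix.smul_apply, smul_eq_mul]
    refine (norm_add_le _ _).trans (add_le_add ?_ ?_)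
    · simpa using norm_mul_apply_le zero_le_one (hcm ht) hbot i j
    · rw [norm_mul, Complex.norm_I, one_mul]
      simpa using norm_mul_apply_le ha (hcm hu) hMK i j
  set G := cellInv A X * (transl S * g)
  have hnum : actNum G z = cmat A⁻¹ * (actNum g z + cmat S * J) - cmat (A⁻¹ * X) * J := by
    have hneg : cmat (-(A⁻¹ * X)) = - cmat (A⁻¹ * X) := by
      rw [← zero_sub, cmat_sub, cmat_zero, zero_sub]
    rw [actNum_mul, actNum_transl_mul, actDen_transl_mul, cellInv, Matrix.toBlocks_fromBlocks₁₁,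
      Matrix.toBlocks_fromBlocks₁₂, hneg, Matrix.neg_mul, sub_eq_add_neg]
  have hden : actDen G z = cmat Aᵀ * J := by
    rw [actDen_mul, actDen_transl_mul, cellInv, Matrix.toBlocks_fromBlocks₂₁,
      Matrix.toBlocks_fromBlocks₂₂, cmat_zero, Matrix.zero_mul, zero_add]
  have h1 := hC G.toBlocks₁₁ G.toBlocks₁₂ (m * (m * (a * K)) + m * (a * K)) (by positivity)
    (fun i j => by
      have := hbd i j
      rwa [← hnum] at this)
  have h2 := hC G.toBlocks₂₁ G.toBlocks₂₂ (m * (m * (a * K)) + m * (a * K)) (by positivity)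
    (fun i j => by
      have h := hbot i j
      rw [← hden] at h
      exact h.trans (le_add_of_nonneg_left (by positivity)))
  have e : C * (m * (m * (a * K)) + m * (a * K)) = C * (m * (m * K) + m * K) * a := by ring
  rw [e] at h1 h2
  rintro (i | i) (j | j)
  · exact h1.1 i j
  · exact h1.2 i j
  · exact h2.1 i j
  · exact h2.2 i j
lemma dyadicDiag_mul_mul_apply {m : ℕ} (k : Fin m → ℕ) (M : Matrix (Fin m) (Fin m) ℝ)
    (i j : Fin m) :
    (dyadicDiag k * M * dyadicDiag k) i j = M i j / 2 ^ (k i + k j) := by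
  rw [dyadicDiag, Matrix.mul_diagonal, Matrix.diagonal_mul, pow_add, one_div, inv_pow, inv_pow]
  field_simp

lemma isUnit_det_dyadicDiag_mul_rmat {m : ℕ} (k : Fin m → ℕ) {N N' : Matrix (Fin m) (Fin m) ℤ}
    (h : N * N' = 1) : IsUnit (dyadicDiag k * rmat N).det := by
  rw [Matrix.det_mul]
  refine IsUnit.mul ?_ ?_
  · rw [dyadicDiag, Matrix.det_diagonal, isUnit_iff_ne_zero]
    exact Finset.prod_ne_zero_iff.mpr fun i _ => by positivity
  · refine IsUnit.of_mul_eq_one (rmat N').det ?_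
    rw [← Matrix.det_mul, ← rmat_mul, h, rmat_one, Matrix.det_one]

/-- Modulo integral symmetric matrices, every symmetric real matrix is close to the base point
of one of finitely many cells. -/
lemma exists_cell_translation {m : ℕ} (k : Fin m → ℕ) {N N' : Matrix (Fin m) (Fin m) ℤ}
    (hN : N * N' = 1) {X : Matrix (Fin m) (Fin m) ℝ} (hX : X.IsSymm) :
    ∃ (s S : Matrix (Fin m) (Fin m) ℤ) (t : Matrix (Fin m) (Fin m) ℝ), s.IsSymm ∧ S.IsSymm ∧
      (∀ i j, 0 ≤ s i j ∧ s i j < 2 ^ (k i + k j)) ∧ (∀ i j, |t i j| ≤ 1) ∧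
      X + rmat S = dyadicDiag k * rmat s * dyadicDiag k
        + (dyadicDiag k * rmat N) * t * (dyadicDiag k * rmat N)ᵀ := by
  set A := dyadicDiag k * rmat N with hA
  have hAu : IsUnit A.det := isUnit_det_dyadicDiag_mul_rmat k hN
  have hAA : A * A⁻¹ = 1 := Matrix.mul_nonsing_inv _ hAu
  have hAA' : A⁻¹ᵀ * Aᵀ = 1 := by rw [← Matrix.transpose_mul, hAA, Matrix.transpose_one]
  set F := A⁻¹ * X * A⁻¹ᵀ with hF
  have hFs : F.IsSymm := by
    rw [Matrix.IsSymm, hF, Matrix.transpose_mul, Matrix.transpose_mul, Matrix.transpose_transpose,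
      hX.eq, Matrix.mul_assoc]
  have hXF : X = A * F * Aᵀ := by
    rw [hF, ← Matrix.mul_assoc A, ← Matrix.mul_assoc A, hAA, Matrix.one_mul, Matrix.mul_assoc X,
      hAA', Matrix.mul_one]
  set fl : Matrix (Fin m) (Fin m) ℤ := Matrix.of fun i j => ⌊F i j⌋ with hfl
  have hfls : fl.IsSymm := by
    ext i j
    simp only [hfl, Matrix.transpose_apply, Matrix.of_apply]
    rw [hFs.apply i j]
  set s₁ := N * fl * Nᵀ with hs₁
  have hs₁s : s₁.IsSymm := by
    rw [Matrix.IsSymm, hs₁, Matrix.transpose_mul, Matrix.transpose_mul, Matrix.transpose_transpose,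
      hfls.eq, Matrix.mul_assoc]
  refine ⟨Matrix.of fun i j => s₁ i j % 2 ^ (k i + k j),
    Matrix.of fun i j => -(s₁ i j / 2 ^ (k i + k j)), F - rmat fl, ?_, ?_, ?_, ?_, ?_⟩
  · ext i j
    simp only [Matrix.transpose_apply, Matrix.of_apply]
    rw [hs₁s.apply i j, add_comm]
  · ext i j
    simp only [Matrix.transpose_apply, Matrix.of_apply]
    rw [hs₁s.apply i j, add_comm]
  · exact fun i j => ⟨Int.emod_nonneg _ (by positivity), Int.emod_lt_of_pos _ (by positivity)⟩
  · intro i j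
    have h : (F - rmat fl) i j = Int.fract (F i j) := rfl
    rw [h, abs_of_nonneg (Int.fract_nonneg _)]
    exact (Int.fract_lt_one _).le
  · have hs₁A : A * rmat fl * Aᵀ = dyadicDiag k * rmat s₁ * dyadicDiag k := by
      have : rmat Nᵀ = (rmat N)ᵀ := rfl
      have hD : (dyadicDiag k)ᵀ = dyadicDiag k := Matrix.diagonal_transpose _
      rw [hs₁, rmat_mul, rmat_mul, this, hA, Matrix.transpose_mul, hD]
      simp only [Matrix.mul_assoc]
    rw [Matrix.mul_sub, Matrix.sub_mul, ← hXF, hs₁A]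
    ext i j
    rw [Matrix.add_apply, Matrix.add_apply, Matrix.sub_apply, dyadicDiag_mul_mul_apply,
      dyadicDiag_mul_mul_apply]
    have h : (s₁ i j : ℝ) = 2 ^ (k i + k j) * ((s₁ i j / 2 ^ (k i + k j) : ℤ) : ℝ)
        + ((s₁ i j % 2 ^ (k i + k j) : ℤ) : ℝ) := by
      have := Int.mul_ediv_add_emod (s₁ i j) (2 ^ (k i + k j))
      exact_mod_cast this.symm
    simp only [rmat, Matrix.map_apply, Matrix.of_apply]
    rw [h]
    push_cast
    field_simp
    ring

/-- The inverse `-W gᵀ W` of a symplectic matrix. -/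
def sympInv {m : ℕ} (g : Matrix (Fin m ⊕ Fin m) (Fin m ⊕ Fin m) ℝ) :
    Matrix (Fin m ⊕ Fin m) (Fin m ⊕ Fin m) ℝ :=
  -(Wmat m * gᵀ * Wmat m)

lemma Wmat_mul_self (m : ℕ) : Wmat m * Wmat m = -1 := by
  rw [Wmat, Matrix.fromBlocks_multiply, ← Matrix.fromBlocks_one, Matrix.fromBlocks_neg]
  simp

lemma IsSymplectic.sympInv_mul {m : ℕ} {g : Matrix (Fin m ⊕ Fin m) (Fin m ⊕ Fin m) ℝ}
    (hg : IsSymplectic g) : sympInv g * g = 1 := by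
  rw [sympInv, Matrix.neg_mul, Matrix.mul_assoc (Wmat m), Matrix.mul_assoc (Wmat m), hg,
    Wmat_mul_self, neg_neg]

lemma IsSymplectic.mul_sympInv {m : ℕ} {g : Matrix (Fin m ⊕ Fin m) (Fin m ⊕ Fin m) ℝ}
    (hg : IsSymplectic g) : g * sympInv g = 1 :=
  mul_eq_one_comm.mp hg.sympInv_mul

lemma sympInv_eq_fromBlocks {m : ℕ} (g : Matrix (Fin m ⊕ Fin m) (Fin m ⊕ Fin m) ℝ) :
    sympInv g = Matrix.fromBlocks g.toBlocks₂₂ᵀ (-g.toBlocks₁₂ᵀ) (-g.toBlocks₂₁ᵀ)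
      g.toBlocks₁₁ᵀ := by
  conv_lhs => rw [← Matrix.fromBlocks_toBlocks g]
  rw [sympInv, Wmat, Matrix.fromBlocks_transpose, Matrix.fromBlocks_multiply,
    Matrix.fromBlocks_multiply, Matrix.fromBlocks_neg]
  simp

lemma abs_sympInv_apply_le {m : ℕ} {g : Matrix (Fin m ⊕ Fin m) (Fin m ⊕ Fin m) ℝ} {b : ℝ}
    (hg : ∀ i j, |g i j| ≤ b) (i j : Fin m ⊕ Fin m) : |sympInv g i j| ≤ b := by
  rw [sympInv_eq_fromBlocks]
  rcases i with i | i <;> rcases j with j | j <;>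
    simp [Matrix.toBlocks₁₁, Matrix.toBlocks₁₂, Matrix.toBlocks₂₁, Matrix.toBlocks₂₂, hg]

lemma IsIntegralMat.sympInv {m : ℕ} {g : Matrix (Fin m ⊕ Fin m) (Fin m ⊕ Fin m) ℝ}
    (hg : IsIntegralMat g) : IsIntegralMat (sympInv g) := by
  have hneg : ∀ i j, ∃ n : ℤ, -g i j = (n : ℝ) := fun i j => by
    obtain ⟨n, hn⟩ := hg i j
    exact ⟨-n, by rw [hn]; push_cast; rfl⟩
  intro i j
  rw [sympInv_eq_fromBlocks]
  rcases i with i | i <;> rcases j with j | j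
  · exact hg _ _
  · exact hneg _ _
  · exact hneg _ _
  · exact hg _ _

lemma IsIntegralMat.mul {m : ℕ} {g h : Matrix (Fin m ⊕ Fin m) (Fin m ⊕ Fin m) ℝ}
    (hg : IsIntegralMat g) (hh : IsIntegralMat h) : IsIntegralMat (g * h) := by
  choose a ha using hg
  choose b hb using hh
  refine fun i j => ⟨∑ l, a i l * b l j, ?_⟩
  push_cast
  rw [Matrix.mul_apply]
  exact Finset.sum_congr rfl fun l _ => by rw [ha, hb]

lemma isIntegralMat_transl {m : ℕ} (S : Matrix (Fin m) (Fin m) ℤ) :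
    IsIntegralMat (transl (rmat S)) := by
  have h1 : ∀ i j : Fin m, ∃ n : ℤ, (1 : Matrix (Fin m) (Fin m) ℝ) i j = (n : ℝ) := fun i j =>
    ⟨(1 : Matrix (Fin m) (Fin m) ℤ) i j, by
      rw [Matrix.one_apply, Matrix.one_apply]; split_ifs <;> simp⟩
  rintro (i | i) (j | j)
  · exact h1 i j
  · exact ⟨S i j, rfl⟩
  · exact ⟨0, by simp [transl]⟩
  · exact h1 i j

/-- Two integral symplectic matrices which are close to the same cell differ by a bounded integral
factor. -/
lemma exists_bounded_factor {m : ℕ} {L g h : Matrix (Fin m ⊕ Fin m) (Fin m ⊕ Fin m) ℝ} {b : ℝ}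
    (hb : 0 ≤ b) (hL : IsSymplectic L) (hg : IsSymplectic g) (hgi : IsIntegralMat g)
    (hhi : IsIntegralMat h) (hLg : ∀ i j, |(L * g) i j| ≤ b) (hLh : ∀ i j, |(L * h) i j| ≤ b) :
    ∃ M : Matrix (Fin m ⊕ Fin m) (Fin m ⊕ Fin m) ℤ, (∀ i j, |(M i j : ℝ)| ≤ 2 * m * b ^ 2) ∧
      g * M.map (Int.cast : ℤ → ℝ) = h := by
  choose M hM using hgi.sympInv.mul hhi
  have hMe : (Matrix.of M).map (Int.cast : ℤ → ℝ) = sympInv g * h := by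
    ext i j
    exact (hM i j).symm
  have hLinv : sympInv (L * g) * (L * h) = sympInv g * h := by
    have h1 : sympInv (L * g) * L = sympInv g := by
      calc sympInv (L * g) * L = sympInv (L * g) * (L * g) * sympInv g := by
            rw [Matrix.mul_assoc, Matrix.mul_assoc L, hg.mul_sympInv, Matrix.mul_one]
        _ = _ := by rw [(hL.mul hg).sympInv_mul, Matrix.one_mul]
    rw [← Matrix.mul_assoc, h1]
  refine ⟨Matrix.of M, fun i j => ?_, ?_⟩
  · have h1 := norm_mul_apply_le (𝕜 := ℝ) hb (abs_sympInv_apply_le hLg) hLh i j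
    rw [hLinv, hM i j, Fintype.card_sum, Fintype.card_fin] at h1
    calc |((Matrix.of M) i j : ℝ)| ≤ _ := h1
      _ = 2 * m * b ^ 2 := by push_cast; ring
  · rw [hMe, ← Matrix.mul_assoc, hg.mul_sympInv, Matrix.one_mul]
/-- A family of real numbers is summable if it is bounded by a function of a label, and the number
of indices with a given label is controlled. -/
lemma summable_of_injective_label {ι κ' V : Type*} (p : ι → κ') (q : ι → V) (T : κ' → Finset V)
    {g : κ' → ℝ} {f : ι → ℝ} (hinj : ∀ a b, p a = p b → q a = q b → a = b)
    (hq : ∀ i, q i ∈ T (p i)) (hf0 : ∀ i, 0 ≤ f i) (hf : ∀ i, f i ≤ g (p i))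
    (hg : ∀ k, 0 ≤ g k) (hs : Summable fun k => ((T k).card : ℝ) * g k) : Summable f := by
  have h1 : Summable fun x : Σ k, T k => g x.1 := by
    rw [summable_sigma_of_nonneg fun x => hg x.1]
    refine ⟨fun k => Summable.of_finite, ?_⟩
    convert hs using 2 with k
    change ∑' _ : T k, g k = _
    rw [tsum_fintype, Finset.sum_const, Finset.card_univ, Fintype.card_coe, nsmul_eq_mul]
  let e : ι → Σ k, T k := fun i => ⟨p i, q i, hq i⟩
  have he : Function.Injective e := by
    intro a b hab
    have hp : p a = p b := congrArg Sigma.fst hab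
    have hqq : q a = q b := congrArg (fun x : Σ k, T k => (x.2 : V)) hab
    exact hinj a b hp hqq
  exact Summable.of_nonneg_of_le hf0 hf (h1.comp_injective he)

lemma summable_prod_geometric {q : ℝ} (hq0 : 0 ≤ q) (hq1 : q < 1) (m : ℕ) :
    Summable fun k : Fin m → ℕ => ∏ i, q ^ k i := by
  induction m with
  | zero => exact Summable.of_finite
  | succ m ih =>
    rw [← (Fin.consEquiv fun _ : Fin (m + 1) => ℕ).summable_iff]
    have := (summable_geometric_of_lt_one hq0 hq1).mul_of_nonneg ih (fun _ => by positivity)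
      fun _ => Finset.prod_nonneg fun _ _ => by positivity
    convert this using 2 with x
    simp [Fin.prod_univ_succ, Fin.consEquiv]

lemma prod_prod_ite_lt {m : ℕ} (a : Fin m → ℝ) :
    ∏ i, ∏ j, (if j < i then 1 else a i * a j) = ∏ i, a i ^ (m + 1) := by
  have h1 : ∀ i j : Fin m, (if j < i then 1 else a i * a j)
      = (if j < i then 1 else a i) * (if j < i then 1 else a j) := by
    intro i j
    split_ifs <;> simp
  have h2 : ∏ i, ∏ j, (if j < i then 1 else a j) = ∏ i, ∏ j, (if i < j then 1 else a i) :=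
    Finset.prod_comm
  simp only [h1, Finset.prod_mul_distrib]
  rw [h2, ← Finset.prod_mul_distrib]
  refine Finset.prod_congr rfl fun i _ => ?_
  rw [← Finset.prod_mul_distrib]
  have h3 : ∀ j, (if j < i then 1 else a i) * (if i < j then 1 else a i)
      = a i * (if i = j then a i else 1) := by
    intro j
    rcases lt_trichotomy i j with h | h | h
    · simp [h, h.not_gt, h.ne]
    · simp [h]
    · simp [h, h.not_gt, h.ne']
  simp only [h3, Finset.prod_mul_distrib, Finset.prod_const, Finset.card_univ, Fintype.card_fin,
    Finset.prod_ite_eq, Finset.mem_univ, if_true]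
  ring

lemma prod_prod_ite_eq {m : ℕ} (a : Fin m → ℝ) :
    ∏ i, ∏ j, (if i = j then 1 else a i) = ∏ i, a i ^ (m - 1) := by
  refine Finset.prod_congr rfl fun i _ => ?_
  rw [Finset.prod_ite, Finset.prod_const_one, one_mul, Finset.prod_const]
  congr 1
  rw [Finset.filter_not, Finset.filter_eq, if_pos (Finset.mem_univ i),
    Finset.card_sdiff_of_subset (Finset.subset_univ _)]
  simp

/-- The integral matrices whose entries lie between those of `lo` and `hi`. -/
def boundedMats {ι κ' : Type*} [Fintype ι] [Fintype κ'] [DecidableEq ι] [DecidableEq κ']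
    (lo hi : ι → κ' → ℤ) : Finset (ι → κ' → ℤ) :=
  Fintype.piFinset fun i => Fintype.piFinset fun j => Finset.Icc (lo i j) (hi i j)

lemma mem_boundedMats {ι κ' : Type*} [Fintype ι] [Fintype κ'] [DecidableEq ι] [DecidableEq κ']
    {lo hi M : ι → κ' → ℤ} : M ∈ boundedMats lo hi ↔ ∀ i j, lo i j ≤ M i j ∧ M i j ≤ hi i j := by
  simp [boundedMats]

lemma card_boundedMats_le {ι κ' : Type*} [Fintype ι] [Fintype κ'] [DecidableEq ι] [DecidableEq κ']
    {lo hi : ι → κ' → ℤ} {a : ι → κ' → ℝ} (ha : ∀ i j, 0 ≤ a i j)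
    (h : ∀ i j, ((hi i j + 1 - lo i j : ℤ) : ℝ) ≤ a i j) :
    ((boundedMats lo hi).card : ℝ) ≤ ∏ i, ∏ j, a i j := by
  simp only [boundedMats, Fintype.card_piFinset, Int.card_Icc]
  push_cast
  refine Finset.prod_le_prod (fun _ _ => Finset.prod_nonneg fun _ _ => by positivity) fun i _ =>
    Finset.prod_le_prod (fun _ _ => by positivity) fun j _ => ?_
  have h1 : ((hi i j + 1 - lo i j).toNat : ℝ) = ((max (hi i j + 1 - lo i j) 0 : ℤ) : ℝ) := by
    exact_mod_cast congrArg (Int.cast : ℤ → ℝ) (Int.toNat_eq_max (hi i j + 1 - lo i j))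
  rw [h1, Int.cast_max, Int.cast_zero]
  exact max_le (h i j) (ha i j)
/-- The triples of integral matrices which distinguish the group elements in the cells of a given
shape `k`. -/
def cellLabels {m : ℕ} (c b : ℝ) (k : Fin m → ℕ) :
    Finset ((Fin m → Fin m → ℤ) × (Fin m → Fin m → ℤ) ×
      (Fin m ⊕ Fin m → Fin m ⊕ Fin m → ℤ)) :=
  boundedMats (fun i j => if i = j then 1 else -⌊2 ^ k i * c⌋)
      (fun i j => if i = j then 1 else ⌊2 ^ k i * c⌋) ×ˢ
    boundedMats (fun _ _ => 0) (fun i j => if j < i then 0 else 2 ^ (k i + k j) - 1) ×ˢ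
    boundedMats (fun _ _ => -⌊b⌋) (fun _ _ => ⌊b⌋)

lemma card_cellLabels_le {m : ℕ} (hm : m ≠ 0) {c b : ℝ} (hc : 1 ≤ c) (hb : 0 ≤ b)
    (k : Fin m → ℕ) :
    ((cellLabels c b k).card : ℝ)
      ≤ (3 * c) ^ (m * (m - 1)) * (2 * b + 1) ^ ((m + m) * (m + m)) * ∏ i, (2 ^ (2 * m)) ^ k i := by
  have hk : ∀ i, (1 : ℝ) ≤ 2 ^ k i := fun i => one_le_pow₀ one_le_two
  have h1 := card_boundedMats_le (lo := fun i j : Fin m => if i = j then 1 else -⌊2 ^ k i * c⌋)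
    (hi := fun i j => if i = j then 1 else ⌊2 ^ k i * c⌋)
    (a := fun i j => if i = j then 1 else 3 * c * 2 ^ k i)
    (fun i j => by split_ifs <;> positivity) (fun i j => by
      split_ifs
      · simp
      · have := Int.floor_le ((2 : ℝ) ^ k i * c)
        push_cast
        nlinarith [hk i])
  have h2 := card_boundedMats_le (lo := fun _ _ : Fin m => 0)
    (hi := fun i j => if j < i then 0 else 2 ^ (k i + k j) - 1)
    (a := fun i j => if j < i then 1 else 2 ^ k i * 2 ^ k j)
    (fun i j => by split_ifs <;> positivity) (fun i j => by
      split_ifs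
      · simp
      · simp [pow_add])
  have h3 := card_boundedMats_le (ι := Fin m ⊕ Fin m) (κ' := Fin m ⊕ Fin m)
    (lo := fun _ _ => -⌊b⌋) (hi := fun _ _ => ⌊b⌋) (a := fun _ _ => 2 * b + 1)
    (fun _ _ => by positivity) (fun _ _ => by
      have := Int.floor_le b
      push_cast
      linarith)
  rw [prod_prod_ite_eq] at h1
  rw [prod_prod_ite_lt] at h2
  simp only [Finset.prod_const, Finset.card_univ, Fintype.card_sum, Fintype.card_fin,
    ← pow_mul] at h3
  rw [cellLabels, Finset.card_product, Finset.card_product]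
  push_cast
  calc _ ≤ _ := mul_le_mul h1 (mul_le_mul h2 h3 (by positivity) (by positivity)) (by positivity)
        (by positivity)
    _ = _ := by
      simp only [mul_pow, Finset.prod_mul_distrib, Finset.prod_const, Finset.card_univ,
        Fintype.card_fin]
      have : ∀ i, ((2 : ℝ) ^ (2 * m)) ^ k i = (2 ^ k i) ^ (m - 1) * (2 ^ k i) ^ (m + 1) := by
        intro i
        rw [← pow_add, ← pow_mul, ← pow_mul, mul_comm]
        congr 2
        omega
      simp only [this, Finset.prod_mul_distrib]
      rw [mul_comm m (m - 1), pow_mul, pow_mul]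
      ring

/-- Up to the integral translation `S`, the point `g·z` with `tr Im(g·z) ≤ r` lies close to the
base point of the cell given by `k`, `N`, `s`; the constant `C` measures the distance. -/
structure InCell {m : ℕ} (C r : ℝ) (g : Matrix (Fin m ⊕ Fin m) (Fin m ⊕ Fin m) ℝ)
    (z : Matrix (Fin m) (Fin m) ℂ) (k : Fin m → ℕ) (N s S : Matrix (Fin m) (Fin m) ℤ) : Prop where
  symm_base : s.IsSymm
  symm_translation : S.IsSymm
  isUnit_det : IsUnit (dyadicDiag k * rmat N).det
  diag_eq_one : ∀ i, N i i = 1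
  abs_le : ∀ i j, |(N i j : ℝ)| ≤ 2 ^ k i * (m * (r * cellBound m r))
  base_mem : ∀ i j, 0 ≤ s i j ∧ s i j < 2 ^ (k i + k j)
  det_le : (imPart (act g z)).det ≤ ∏ i, (2 * r * (1 / 2) ^ k i) ^ 2
  abs_cellInv_mul_le : ∀ i j, |(cellInv (dyadicDiag k * rmat N)
    (dyadicDiag k * rmat s * dyadicDiag k) * (transl (rmat S) * g)) i j| ≤ C * cellBound m r

lemma exists_inCell {m : ℕ} {z : Matrix (Fin m) (Fin m) ℂ} (hz : z ∈ SiegelUHS m) :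
    ∃ C : ℝ, 0 ≤ C ∧ ∀ (g : Matrix (Fin m ⊕ Fin m) (Fin m ⊕ Fin m) ℝ) (r : ℝ), IsSymplectic g →
      1 ≤ r → (imPart (act g z)).trace ≤ r → ∃ k N s S, InCell C r g z k N s S := by
  obtain ⟨C, hC0, hC⟩ := exists_bound_cellInv_mul hz
  refine ⟨C, hC0, fun g r hg hr htr => ?_⟩
  obtain ⟨k, N, N', u, v, hN, huv, hu, hv, hY, hN1, hNb, hdet⟩ :=
    exists_reduced_cholesky (hg.imPart_act_posDef hz) hr htr
  have hX : (rePart (act g z)).IsSymm := by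
    ext i j
    exact congrArg Complex.re ((hg.act_isSymm hz).apply i j)
  obtain ⟨s, S, t, hs, hS, hsb, ht, hXt⟩ := exists_cell_translation k hN hX
  have hA := isUnit_det_dyadicDiag_mul_rmat k hN
  refine ⟨k, N, s, S, hs, hS, hA, hN1, hNb, hsb, hdet, ?_⟩
  refine hC g _ _ _ t u v _ hg hA huv ?_ hu hv ht hXt hY
  rw [cellBound]
  positivity

lemma transl_mul_transl {m : ℕ} (S T : Matrix (Fin m) (Fin m) ℝ) :
    transl S * transl T = transl (S + T) := by
  simp [transl, Matrix.fromBlocks_multiply, add_comm]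

lemma IsReps.eq_of_transl_mul_eq {m : ℕ} {Γ R : Set (Matrix (Fin m ⊕ Fin m) (Fin m ⊕ Fin m) ℝ)}
    (hR : IsReps m Γ R) {g h : Matrix (Fin m ⊕ Fin m) (Fin m ⊕ Fin m) ℝ} (hg : g ∈ R) (hh : h ∈ R)
    {S T : Matrix (Fin m) (Fin m) ℤ} (hS : S.IsSymm) (hT : T.IsSymm)
    (h_eq : transl (rmat S) * g = transl (rmat T) * h) : g = h := by
  have hmem : ∀ U : Matrix (Fin m) (Fin m) ℤ, U.IsSymm → transl (rmat U) ∈ GammaInf m := by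
    intro U hU
    refine ⟨1, rmat U, Or.inl rfl, fun i j => ⟨U i j, rfl⟩, ?_, by simp [transl]⟩
    ext i j
    exact congrArg (Int.cast : ℤ → ℝ) (hU.apply i j)
  have hzero : transl (0 : Matrix (Fin m) (Fin m) ℝ) = 1 := Matrix.fromBlocks_one
  have hsub : rmat (T - S) = -rmat S + rmat T := by
    ext i j
    simp [rmat]
    ring
  refine (hR.2 g (hR.1 hg)).unique ⟨hg, 1, ?_, (Matrix.one_mul g).symm⟩
    ⟨hh, transl (rmat (T - S)), hmem _ (hT.sub hS), ?_⟩
  · have := hmem 0 Matrix.isSymm_zero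
    rwa [show rmat (0 : Matrix (Fin m) (Fin m) ℤ) = 0 by ext; simp [rmat], hzero] at this
  · rw [hsub, ← transl_mul_transl, Matrix.mul_assoc, ← h_eq, ← Matrix.mul_assoc, transl_mul_transl,
      neg_add_cancel, hzero, Matrix.one_mul]
lemma card_cellLabels_mul_le {m : ℕ} (hm : m ≠ 0) (C c σ : ℝ) :
    ∃ (D : ℝ) (p : ℕ), 0 ≤ D ∧ ∀ (r : ℝ) (k : Fin m → ℕ), 1 ≤ r →
      ((cellLabels (m * (r * cellBound m r)) (2 * m * (C * cellBound m r) ^ 2) k).card : ℝ) *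
        (Real.exp (-c * (r - 2)) * (∏ i, (2 * r * (1 / 2) ^ k i) ^ 2) ^ σ)
      ≤ D * (r ^ p * Real.exp (-c * r)) * ∏ i, ((2 : ℝ) ^ (2 * m) * (1 / 4) ^ σ) ^ k i := by
  set a : ℝ := (m.factorial : ℝ) * 2 ^ m with ha
  set e₁ := m * (m - 1)
  set e₂ := (m + m) * (m + m)
  set d := ⌈σ⌉₊
  refine ⟨Real.exp (2 * c) * (3 * (m * a)) ^ e₁ * (4 * m * (C * a) ^ 2 + 1) ^ e₂ * (2 ^ (2 * m)) ^ d,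
    (m + 1) * e₁ + 2 * m * e₂ + 2 * m * d, by positivity, fun r k hr => ?_⟩
  have hr0 : 0 < r := by linarith
  have hcb : cellBound m r = a * r ^ m := by rw [cellBound, ha, mul_pow]; ring
  have hm1 : (1 : ℝ) ≤ m := by exact_mod_cast Nat.one_le_iff_ne_zero.mpr hm
  have hcb1 : 1 ≤ cellBound m r := by
    have := le_cellBound hm hr
    linarith
  have hc1 : 1 ≤ m * (r * cellBound m r) :=
    one_le_mul_of_one_le_of_one_le hm1 (one_le_mul_of_one_le_of_one_le hr hcb1)
  have h1 := card_cellLabels_le hm hc1 (b := 2 * m * (C * cellBound m r) ^ 2) (by positivity) k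
  have h2 : 3 * (m * (r * cellBound m r)) = 3 * (m * a) * r ^ (m + 1) := by rw [hcb]; ring
  have h3 : 2 * (2 * m * (C * cellBound m r) ^ 2) + 1
      ≤ (4 * m * (C * a) ^ 2 + 1) * r ^ (2 * m) := by
    have : (1 : ℝ) ≤ r ^ (2 * m) := one_le_pow₀ hr
    calc _ = 4 * m * (C * a) ^ 2 * r ^ (2 * m) + 1 := by rw [hcb]; ring
      _ ≤ _ := by linarith
  have h4 : (∏ i, (2 * r * (1 / 2) ^ k i) ^ 2) ^ σ
      ≤ ((2 * r) ^ (2 * m)) ^ d * ∏ i, ((1 / 4 : ℝ) ^ σ) ^ k i := by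
    have h5 : ∏ i, (2 * r * (1 / 2) ^ k i) ^ 2 = (2 * r) ^ (2 * m) * ∏ i, (1 / 4 : ℝ) ^ k i := by
      simp only [mul_pow, Finset.prod_mul_distrib, Finset.prod_const, Finset.card_univ,
        Fintype.card_fin]
      congr 1
      · simp only [← pow_mul]
      · refine Finset.prod_congr rfl fun i _ => ?_
        rw [← pow_mul, mul_comm, pow_mul]
        norm_num
    have h6 : (∏ i, (1 / 4 : ℝ) ^ k i) ^ σ = ∏ i, ((1 / 4 : ℝ) ^ σ) ^ k i := by
      rw [← Real.finsetProd_rpow _ _ fun i _ => by positivity]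
      refine Finset.prod_congr rfl fun i _ => ?_
      rw [← Real.rpow_natCast, ← Real.rpow_natCast, ← Real.rpow_mul (by norm_num),
        ← Real.rpow_mul (by norm_num), mul_comm]
    rw [h5, Real.mul_rpow (by positivity) (Finset.prod_nonneg fun i _ => by positivity), h6]
    refine mul_le_mul_of_nonneg_right ?_ (Finset.prod_nonneg fun i _ => by positivity)
    rw [← Real.rpow_natCast _ d]
    exact Real.rpow_le_rpow_of_exponent_le (one_le_pow₀ (by linarith)) (Nat.le_ceil σ)
  have hexp : Real.exp (-c * (r - 2)) = Real.exp (2 * c) * Real.exp (-c * r) := by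
    rw [← Real.exp_add]
    ring_nf
  have hP : 0 ≤ ∏ i, ((2 : ℝ) ^ (2 * m)) ^ k i := Finset.prod_nonneg fun i _ => by positivity
  have hQ : 0 ≤ ∏ i, ((1 / 4 : ℝ) ^ σ) ^ k i := Finset.prod_nonneg fun i _ => by positivity
  have hR : 0 ≤ ∏ i, (2 * r * (1 / 2) ^ k i) ^ 2 := Finset.prod_nonneg fun i _ => by positivity
  calc _ ≤ ((3 * (m * a) * r ^ (m + 1)) ^ e₁ * ((4 * m * (C * a) ^ 2 + 1) * r ^ (2 * m)) ^ e₂ *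
          ∏ i, (2 ^ (2 * m)) ^ k i) * (Real.exp (2 * c) * Real.exp (-c * r) *
          (((2 * r) ^ (2 * m)) ^ d * ∏ i, ((1 / 4 : ℝ) ^ σ) ^ k i)) := by
        rw [hexp]
        refine mul_le_mul (h1.trans ?_) ?_ (by positivity) (by positivity)
        · rw [h2]
          gcongr
        · gcongr
    _ = _ := by
        simp only [mul_pow _ _ (k _), Finset.prod_mul_distrib]
        rw [mul_pow _ (r ^ (m + 1)), mul_pow _ (r ^ (2 * m)), mul_pow 2 r, mul_pow _ (r ^ (2 * m)),
          ← pow_mul r, ← pow_mul r, ← pow_mul r, pow_add, pow_add]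
        ring

lemma summable_pow_mul_exp_mul_prod {c q : ℝ} (hc : 0 < c) (hq0 : 0 ≤ q) (hq1 : q < 1) (m p : ℕ) :
    Summable fun x : ℕ × (Fin m → ℕ) =>
      (((x.1 : ℝ) + 1) ^ p * Real.exp (-c * ((x.1 : ℝ) + 1))) * ∏ i, q ^ x.2 i := by
  have h1 := (summable_nat_add_iff 1).mpr (Real.summable_pow_mul_exp_neg_nat_mul p hc)
  simp only [Nat.cast_add, Nat.cast_one] at h1
  have h2 := h1.mul_of_nonneg (summable_prod_geometric hq0 hq1 m) (fun _ => by positivity)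
    fun _ => Finset.prod_nonneg fun _ _ => by positivity
  exact h2

/-- Convergence of the majorant `∑ exp(-c tr Im(γ·z)) det(Im(γ·z))^σ` over `Γ_∞\Γ` for `σ > m`. -/
theorem summable_exp_neg_trace_mul_det_rpow {m : ℕ} (hm : m ≠ 0)
    {Γ R : Set (Matrix (Fin m ⊕ Fin m) (Fin m ⊕ Fin m) ℝ)} (hΓ : IsModularSubgroup m Γ)
    (hR : IsReps m Γ R) {z : Matrix (Fin m) (Fin m) ℂ} (hz : z ∈ SiegelUHS m) {c σ : ℝ}
    (hc : 0 < c) (hσ : m < σ) :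
    Summable fun γ : R => Real.exp (-c * (imPart (act (γ : Matrix _ _ ℝ) z)).trace) *
      (imPart (act (γ : Matrix _ _ ℝ) z)).det ^ σ := by
  have hσ0 : 0 ≤ σ := (Nat.cast_nonneg m).trans hσ.le
  have hsymp : ∀ γ : R, IsSymplectic (γ : Matrix _ _ ℝ) := fun γ => hΓ.symplectic _ (hR.1 γ.2)
  have hint : ∀ γ : R, IsIntegralMat (γ : Matrix _ _ ℝ) := fun γ => hΓ.integral _ (hR.1 γ.2)
  have hpos : ∀ γ : R, (imPart (act (γ : Matrix _ _ ℝ) z)).PosDef :=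
    fun γ => (hsymp γ).imPart_act_posDef hz
  have htr0 : ∀ γ : R, 0 ≤ (imPart (act (γ : Matrix _ _ ℝ) z)).trace :=
    fun γ => Finset.sum_nonneg fun i _ => (hpos γ).posSemidef.diag_nonneg
  obtain ⟨C, hC0, hC⟩ := exists_inCell hz
  obtain ⟨n, hn⟩ : ∃ n : R → ℕ, ∀ γ : R, n γ = ⌈(imPart (act (γ : Matrix _ _ ℝ) z)).trace⌉₊ :=
    ⟨_, fun _ => rfl⟩
  obtain ⟨r, hr⟩ : ∃ r : ℕ → ℝ, ∀ n, r n = n + 1 := ⟨_, fun _ => rfl⟩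
  have hr1 : ∀ n, 1 ≤ r n := fun n => by simp [hr]
  have htr : ∀ γ : R, (imPart (act (γ : Matrix _ _ ℝ) z)).trace ≤ r (n γ) := fun γ => by
    have := Nat.le_ceil (imPart (act (γ : Matrix _ _ ℝ) z)).trace
    rw [hr, hn]
    linarith
  have hcell : ∀ γ : R, ∃ k N s S, InCell C (r (n γ)) γ z k N s S :=
    fun γ => hC γ (r (n γ)) (hsymp γ) (hr1 _) (htr γ)
  simp only [Classical.skolem] at hcell
  obtain ⟨k, N, s, S, hcell⟩ := hcell
  let ℓ : R → ℕ × (Fin m → ℕ) × Matrix (Fin m) (Fin m) ℤ × Matrix (Fin m) (Fin m) ℤ :=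
    fun γ => (n γ, k γ, N γ, s γ)
  have hbase : ∃ base : R → R, (∀ γ, ℓ (base γ) = ℓ γ) ∧
      ∀ γ δ, ℓ γ = ℓ δ → base γ = base δ := by
    refine ⟨fun γ => Set.rangeSplitting ℓ ⟨ℓ γ, γ, rfl⟩, fun γ => ?_, fun γ δ h => ?_⟩
    · exact Set.apply_rangeSplitting ℓ ⟨ℓ γ, γ, rfl⟩
    · simp only [h]
  obtain ⟨base, hbase1, hbase2⟩ := hbase
  have hM : ∀ γ : R, ∃ M : Matrix (Fin m ⊕ Fin m) (Fin m ⊕ Fin m) ℤ,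
      (∀ i j, |(M i j : ℝ)| ≤ 2 * m * (C * cellBound m (r (n γ))) ^ 2) ∧
      (transl (rmat (S (base γ))) * (base γ : Matrix _ _ ℝ)) * M.map (Int.cast : ℤ → ℝ)
        = transl (rmat (S γ)) * (γ : Matrix _ _ ℝ) := by
    intro γ
    have hsymm : ∀ U : Matrix (Fin m) (Fin m) ℤ, U.IsSymm → (rmat U).IsSymm := fun U hU => by
      ext i j
      exact congrArg (Int.cast : ℤ → ℝ) (hU.apply i j)
    have hL : IsSymplectic (cellInv (dyadicDiag (k γ) * rmat (N γ))
        (dyadicDiag (k γ) * rmat (s γ) * dyadicDiag (k γ))) := by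
      refine isSymplectic_cellInv (hcell γ).isUnit_det ?_
      ext i j
      rw [Matrix.transpose_apply, dyadicDiag_mul_mul_apply, dyadicDiag_mul_mul_apply,
        (hsymm _ (hcell γ).symm_base).apply i j, add_comm]
    have hb := hbase1 γ
    simp only [ℓ, Prod.mk.injEq] at hb
    obtain ⟨hb1, hb2, hb3, hb4⟩ := hb
    refine exists_bounded_factor ?_ hL ((isSymplectic_transl (hsymm _ (hcell _).symm_translation)).mul (hsymp _))
      ((isIntegralMat_transl _).mul (hint _)) ((isIntegralMat_transl _).mul (hint _)) ?_ (hcell γ).abs_cellInv_mul_le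
    · have := hr1 (n γ)
      rw [cellBound]
      positivity
    · have := (hcell (base γ)).abs_cellInv_mul_le
      rwa [hb1, hb2, hb3, hb4] at this
  choose M hMb hMe using hM
  obtain ⟨D, p, hD0, hD⟩ := card_cellLabels_mul_le hm C c σ
  refine summable_of_injective_label (fun γ => (n γ, k γ))
    (fun γ => (N γ, fun i j => if j < i then 0 else s γ i j, M γ))
    (fun x => cellLabels (m * (r x.1 * cellBound m (r x.1)))
      (2 * m * (C * cellBound m (r x.1)) ^ 2) x.2)
    (g := fun x => Real.exp (-c * (r x.1 - 2)) * (∏ i, (2 * r x.1 * (1 / 2) ^ x.2 i) ^ 2) ^ σ)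
    ?_ ?_ ?_ ?_ ?_ ?_
  · intro γ δ hp hq
    simp only [Prod.mk.injEq] at hp hq
    have hsγδ : s γ = s δ := by
      ext i j
      have h1 : ∀ i j, ¬ j < i → s γ i j = s δ i j := fun i j hij => by
        simpa [hij] using congrFun (congrFun hq.2.1 i) j
      by_cases hij : j < i
      · rw [← (hcell γ).symm_base.apply, ← (hcell δ).symm_base.apply, h1 j i hij.not_gt]
      · exact h1 i j hij
    have hb : base γ = base δ := hbase2 γ δ <| by
      simp only [ℓ, hp.1, hp.2, hsγδ, hq.1]
    refine Subtype.ext (hR.eq_of_transl_mul_eq γ.2 δ.2 (hcell γ).symm_translation (hcell δ).symm_translation ?_)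
    rw [← hMe γ, ← hMe δ, hb, show M γ = M δ from hq.2.2]
  · intro γ
    have habs : ∀ {a : ℤ} {x : ℝ}, |(a : ℝ)| ≤ x → -⌊x⌋ ≤ a ∧ a ≤ ⌊x⌋ := fun {a x} h => by
      rw [neg_le, Int.le_floor, Int.le_floor]
      push_cast
      exact ⟨by linarith [(abs_le.mp h).1], (abs_le.mp h).2⟩
    refine Finset.mem_product.mpr ⟨mem_boundedMats.mpr fun i j => ?_,
      Finset.mem_product.mpr ⟨mem_boundedMats.mpr fun i j => ?_,
        mem_boundedMats.mpr fun i j => habs (hMb γ i j)⟩⟩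
    · by_cases hij : i = j
      · subst hij
        simp [(hcell γ).diag_eq_one]
      · simpa [hij] using habs ((hcell γ).abs_le i j)
    · by_cases hij : j < i
      · simp [hij]
      · have := (hcell γ).base_mem i j
        simp only [hij, if_false]
        omega
  · exact fun γ => mul_nonneg (Real.exp_nonneg _) (Real.rpow_nonneg (hpos γ).det_pos.le _)
  · intro γ
    refine mul_le_mul (Real.exp_le_exp.mpr ?_) (Real.rpow_le_rpow (hpos γ).det_pos.le (hcell γ).det_le hσ0)
      (Real.rpow_nonneg (hpos γ).det_pos.le _) (Real.exp_nonneg _)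
    have h1 := Nat.ceil_lt_add_one (htr0 γ)
    have h2 : r (n γ) - 2 ≤ (imPart (act (γ : Matrix _ _ ℝ) z)).trace := by
      rw [hr, hn]
      linarith
    nlinarith
  · exact fun x => mul_nonneg (Real.exp_nonneg _)
      (Real.rpow_nonneg (Finset.prod_nonneg fun _ _ => sq_nonneg _) _)
  · have hq1 : (2 : ℝ) ^ (2 * m) * (1 / 4) ^ σ < 1 := by
      have h1 : (2 : ℝ) ^ (2 * m) = 4 ^ (m : ℝ) := by
        rw [pow_mul, Real.rpow_natCast]
        norm_num
      rw [h1, one_div, Real.inv_rpow (by norm_num), ← div_eq_mul_inv, div_lt_one (by positivity)]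
      exact Real.rpow_lt_rpow_of_exponent_lt (by norm_num) hσ
    refine Summable.of_nonneg_of_le (fun x => ?_) (fun x => hD (r x.1) x.2 (hr1 _)) ?_
    · exact mul_nonneg (Nat.cast_nonneg _) (mul_nonneg (Real.exp_nonneg _)
        (Real.rpow_nonneg (Finset.prod_nonneg fun _ _ => sq_nonneg _) _))
    · simp only [mul_assoc D]
      have h2 := (summable_pow_mul_exp_mul_prod hc (by positivity) hq1 m p).mul_left D
      simp only [← hr] at h2
      exact h2
lemma exists_mul_trace_le {m : ℕ} {τ : Matrix (Fin m) (Fin m) ℝ} (hτ : τ.PosDef) :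
    ∃ l : ℝ, 0 < l ∧ l ≤ 1 ∧ ∀ Y : Matrix (Fin m) (Fin m) ℝ, Y.PosDef →
      l * Y.trace ≤ (τ * Y).trace := by
  obtain ⟨A, -, -, hA⟩ := exists_cholesky hτ
  have hAu : IsUnit A.det := by
    rw [isUnit_iff_ne_zero]
    intro h
    have := hτ.det_pos
    rw [← hA, Matrix.det_mul, h, zero_mul] at this
    exact this.false
  obtain ⟨b, hb0, hb⟩ := exists_norm_apply_le A⁻¹ᵀ
  have hinv : A⁻¹ᵀ * Aᵀ = 1 := by
    rw [← Matrix.transpose_mul, Matrix.mul_nonsing_inv _ hAu, Matrix.transpose_one]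
  set K : ℝ := m * (m * (m * b) ^ 2)
  have hK : 0 ≤ K := by positivity
  refine ⟨1 / (K + 1), by positivity, by rw [div_le_one (by positivity)]; linarith, fun Y hY => ?_⟩
  obtain ⟨B, -, -, hB⟩ := exists_cholesky hY
  set q := (τ * Y).trace with hq
  have hqe : ((Aᵀ * B) * (Aᵀ * B)ᵀ).trace = q := by
    calc ((Aᵀ * B) * (Aᵀ * B)ᵀ).trace = (Aᵀ * (B * Bᵀ * A)).trace := by
          rw [Matrix.transpose_mul, Matrix.transpose_transpose]
          simp only [Matrix.mul_assoc]
      _ = (B * Bᵀ * A * Aᵀ).trace := Matrix.trace_mul_comm _ _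
      _ = (A * Aᵀ * (B * Bᵀ)).trace := by
          rw [Matrix.mul_assoc (B * Bᵀ), Matrix.trace_mul_comm]
      _ = q := by rw [hA, hB]
  have hq0 : 0 ≤ q := by
    rw [← hqe]
    exact Finset.sum_nonneg fun i _ => by
      rw [Matrix.diag_apply, Matrix.mul_apply]
      exact Finset.sum_nonneg fun j _ => mul_self_nonneg _
  have hBij : ∀ i j, B i j ^ 2 ≤ (m * b) ^ 2 * q := by
    intro i j
    have h1 : ∀ i j, ‖(Aᵀ * B) i j‖ ≤ √q := fun i j => by
      rw [Real.norm_eq_abs]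
      exact Real.abs_le_sqrt (hqe ▸ sq_apply_le_trace (Aᵀ * B) i j)
    have h2 := norm_mul_apply_le hb0 hb h1 i j
    rw [← Matrix.mul_assoc, hinv, Matrix.one_mul, Fintype.card_fin, ← mul_assoc] at h2
    calc B i j ^ 2 = ‖B i j‖ ^ 2 := by rw [Real.norm_eq_abs, sq_abs]
      _ ≤ (m * b * √q) ^ 2 := by gcongr
      _ = _ := by rw [mul_pow, Real.sq_sqrt hq0]
  have htr : Y.trace ≤ K * q := by
    rw [← hB, Matrix.trace]
    simp only [Matrix.diag_apply, Matrix.mul_apply, Matrix.transpose_apply, ← sq]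
    calc ∑ i, ∑ j, B i j ^ 2 ≤ ∑ _i : Fin m, ∑ _j : Fin m, (m * b) ^ 2 * q :=
          Finset.sum_le_sum fun i _ => Finset.sum_le_sum fun j _ => hBij i j
      _ = K * q := by simp [K]; ring
  rw [one_div_mul_eq_div, div_le_iff₀ (by positivity)]
  linarith

lemma det_le_trace_pow {m : ℕ} {Y : Matrix (Fin m) (Fin m) ℝ} (hY : Y.PosDef) :
    Y.det ≤ Y.trace ^ m := by
  obtain ⟨A, hlow, -, hA⟩ := exists_cholesky hY
  have h1 : Y.det = ∏ i, A i i ^ 2 := by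
    rw [← hA, Matrix.det_mul, Matrix.det_transpose,
      Matrix.det_of_isLowerTriangular A (fun i j hij => hlow i j hij), ← Finset.prod_mul_distrib]
    simp [sq]
  calc Y.det = ∏ i, A i i ^ 2 := h1
    _ ≤ ∏ _i : Fin m, Y.trace := Finset.prod_le_prod (fun _ _ => sq_nonneg _) fun i _ =>
        hA ▸ sq_apply_le_trace A i i
    _ = Y.trace ^ m := by simp

lemma rpow_le_rpow_add_rpow {x a α β : ℝ} (hx : 0 < x) (hα : α ≤ a) (hβ : a ≤ β) :
    x ^ a ≤ x ^ α + x ^ β := by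
  rcases le_total x 1 with h | h
  · have := Real.rpow_le_rpow_of_exponent_ge hx h hα
    have := Real.rpow_nonneg hx.le β
    linarith
  · have := Real.rpow_le_rpow_of_exponent_le h hβ
    have := Real.rpow_nonneg hx.le α
    linarith

lemma rpow_le_factorial_mul_exp {t a : ℝ} {n : ℕ} (ht : 0 < t) (ha0 : 0 ≤ a) (han : a ≤ n) :
    t ^ a ≤ (1 + n.factorial) * Real.exp (Real.pi * t) := by
  have h1 := rpow_le_rpow_add_rpow ht ha0 han
  rw [Real.rpow_zero, Real.rpow_natCast] at h1
  have h2 := Real.pow_div_factorial_le_exp t ht.le n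
  rw [div_le_iff₀ (by positivity)] at h2
  have h3 : Real.exp t ≤ Real.exp (Real.pi * t) :=
    Real.exp_le_exp.mpr (by nlinarith [Real.pi_gt_three])
  have h4 : 1 ≤ Real.exp (Real.pi * t) := Real.one_le_exp (by positivity)
  have h5 : Real.exp t * n.factorial ≤ Real.exp (Real.pi * t) * n.factorial := by gcongr
  linarith

/-- The elementary estimate behind the absolute convergence; `t`, `T`, `Δ` stand for
`tr(τY)`, `tr Y`, `det Y`. -/
lemma exp_mul_rpow_mul_rpow_le {m n : ℕ} (hm : m ≠ 0) {l t T Δ a e α β : ℝ} (hl : 0 < l)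
    (hl1 : l ≤ 1) (ht : l * T ≤ t) (hT : 0 < T) (hΔ : 0 < Δ) (hΔT : Δ ≤ T ^ m) (ha : |a| ≤ n)
    (hα : α ≤ e) (hβ : e ≤ β) (hα' : α ≤ e + a / m) (hβ' : e + a / m ≤ β) :
    Real.exp (-2 * Real.pi * t) * t ^ a * Δ ^ e
      ≤ (1 + n.factorial + l ^ (-(n : ℝ))) * (Real.exp (-(Real.pi * l) * T) * (Δ ^ α + Δ ^ β)) := by
  have ht0 : 0 < t := (mul_pos hl hT).trans_le ht
  have hexp : Real.exp (-(Real.pi * t)) ≤ Real.exp (-(Real.pi * l) * T) :=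
    Real.exp_le_exp.mpr (by nlinarith [Real.pi_pos])
  have hln : 0 < l ^ (-(n : ℝ)) := Real.rpow_pos_of_pos hl _
  have hS : 0 < Δ ^ α + Δ ^ β := by positivity
  have hE := Real.exp_pos (-(Real.pi * l) * T)
  rcases le_total 0 a with h | h
  · have h1 := rpow_le_factorial_mul_exp ht0 h ((le_abs_self a).trans ha)
    calc Real.exp (-2 * Real.pi * t) * t ^ a * Δ ^ e
        ≤ Real.exp (-2 * Real.pi * t) * ((1 + n.factorial) * Real.exp (Real.pi * t)) *
          (Δ ^ α + Δ ^ β) := by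
          gcongr
          exact rpow_le_rpow_add_rpow hΔ hα hβ
      _ = (1 + n.factorial) * (Real.exp (-(Real.pi * t)) * (Δ ^ α + Δ ^ β)) := by
          rw [show -(Real.pi * t) = -2 * Real.pi * t + Real.pi * t by ring, Real.exp_add]
          ring
      _ ≤ _ := mul_le_mul (by linarith) (mul_le_mul_of_nonneg_right hexp hS.le) (by positivity)
          (by positivity)
  · have hΔm : l * Δ ^ (1 / m : ℝ) ≤ t := by
      refine le_trans ?_ ht
      gcongr
      calc Δ ^ (1 / m : ℝ) ≤ (T ^ m) ^ (1 / m : ℝ) := by gcongr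
        _ = T := by rw [one_div, Real.pow_rpow_inv_natCast hT.le hm]
    have h1 : t ^ a ≤ l ^ (-(n : ℝ)) * Δ ^ (a / m) := by
      calc t ^ a ≤ (l * Δ ^ (1 / m : ℝ)) ^ a :=
            Real.rpow_le_rpow_of_nonpos (by positivity) hΔm h
        _ = l ^ a * Δ ^ (a / m) := by
            rw [Real.mul_rpow hl.le (by positivity), ← Real.rpow_mul hΔ.le, one_div_mul_eq_div]
        _ ≤ _ := mul_le_mul_of_nonneg_right
            (Real.rpow_le_rpow_of_exponent_ge hl hl1 (neg_le_of_abs_le ha)) (by positivity)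
    calc Real.exp (-2 * Real.pi * t) * t ^ a * Δ ^ e
        ≤ Real.exp (-(Real.pi * t)) * (l ^ (-(n : ℝ)) * Δ ^ (a / m)) * Δ ^ e := by
          gcongr
          nlinarith [Real.pi_pos, mul_pos Real.pi_pos ht0]
      _ = l ^ (-(n : ℝ)) * (Real.exp (-(Real.pi * t)) * Δ ^ (e + a / m)) := by
          rw [Real.rpow_add hΔ]
          ring
      _ ≤ l ^ (-(n : ℝ)) * (Real.exp (-(Real.pi * l) * T) * (Δ ^ α + Δ ^ β)) := by
          gcongr
          exact rpow_le_rpow_add_rpow hΔ hα' hβ'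
      _ ≤ _ := by
          gcongr
          have : (0 : ℝ) ≤ n.factorial := Nat.cast_nonneg _
          linarith

lemma norm_term1 {m : ℕ} {τ : Matrix (Fin m) (Fin m) ℝ} (κ : ℕ) (s₁ s₂ : ℂ)
    {g : Matrix (Fin m ⊕ Fin m) (Fin m ⊕ Fin m) ℝ} (hg : IsSymplectic g)
    {z : Matrix (Fin m) (Fin m) ℂ} (hz : z ∈ SiegelUHS m)
    (ht : 0 < (τ * imPart (act g z)).trace) :
    ‖term1 τ κ s₁ s₂ g z‖ = (imPart z).det ^ (-(κ / 2 : ℝ)) *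
      (Real.exp (-2 * Real.pi * (τ * imPart (act g z)).trace) *
        (τ * imPart (act g z)).trace ^ s₁.re * (imPart (act g z)).det ^ (s₂.re + κ / 2)) := by
  have hΔ := (hg.imPart_act_posDef hz).det_pos
  have hδ := hz.2.det_pos
  have him : (cmat τ * act g z).trace.im = (τ * imPart (act g z)).trace := by
    simp [Matrix.trace, Matrix.mul_apply, cmat, imPart]
  have hj : ‖autFactor g z‖ = ((imPart z).det / (imPart (act g z)).det) ^ (1 / 2 : ℝ) := by
    rw [← Real.sqrt_eq_rpow, ← hg.det_imPart_act hz, mul_div_cancel_right₀ _ hΔ.ne',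
      Real.sqrt_sq (norm_nonneg _)]
  have hjκ : ‖autFactor g z ^ (-(κ : ℤ))‖
      = (imPart z).det ^ (-(κ / 2 : ℝ)) * (imPart (act g z)).det ^ (κ / 2 : ℝ) := by
    rw [norm_zpow, hj, ← Real.rpow_intCast, ← Real.rpow_mul (by positivity),
      Real.div_rpow hδ.le hΔ.le, div_eq_mul_inv, ← Real.rpow_neg hΔ.le]
    push_cast
    congr 2 <;> ring
  rw [term1, norm_mul, norm_mul, norm_mul, hjκ, Complex.norm_exp,
    Complex.norm_cpow_eq_rpow_re_of_pos ht, Complex.norm_cpow_eq_rpow_re_of_pos hΔ,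
    Real.rpow_add hΔ]
  have hre : (2 * (Real.pi : ℂ) * Complex.I * (cmat τ * act g z).trace).re
      = -2 * Real.pi * (τ * imPart (act g z)).trace := by
    rw [← him]
    simp
  rw [hre]
  ring

/-- On compact subsets of the region of convergence the terms of the Poincaré series have a
summable majorant. -/
theorem exists_summable_majorant {m : ℕ} (hm : m ≠ 0) (κ : ℕ) {τ : Matrix (Fin m) (Fin m) ℝ}
    (hτ : τ.PosDef) {Γ R : Set (Matrix (Fin m ⊕ Fin m) (Fin m ⊕ Fin m) ℝ)}
    (hΓ : IsModularSubgroup m Γ) (hR : IsReps m Γ R) {z : Matrix (Fin m) (Fin m) ℂ}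
    (hz : z ∈ SiegelUHS m) {K : Set (ℂ × ℂ)} (hK : IsCompact K) (hKR : K ⊆ Region1 m κ) :
    ∃ u : R → ℝ, Summable u ∧
      ∀ (γ : R), ∀ p ∈ K, ‖term1 τ κ p.1 p.2 (γ : Matrix _ _ ℝ) z‖ ≤ u γ := by
  have hm0 : (0 : ℝ) < m := by exact_mod_cast Nat.pos_of_ne_zero hm
  set e : ℂ × ℂ → ℝ := fun p => p.2.re + κ / 2 with he
  set e' : ℂ × ℂ → ℝ := fun p => e p + p.1.re / m with he'
  have hec : Continuous e := by fun_prop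
  have hec' : Continuous e' := by fun_prop
  have hac : Continuous fun p : ℂ × ℂ => |p.1.re| := by fun_prop
  have hegt : ∀ p ∈ K, (m : ℝ) < e p := fun p hp => by
    have := (hKR hp).1
    simp at this
    simp only [he]
    linarith
  have hegt' : ∀ p ∈ K, (m : ℝ) < e' p := fun p hp => by
    have h1 := (hKR hp).2
    have h2 : ((2 / (m : ℂ)) * p.1 + 2 * p.2 + (κ : ℂ)).re = 2 * e' p := by
      have : (2 / (m : ℂ)) = ((2 / m : ℝ) : ℂ) := by push_cast; rfl
      rw [this, Complex.add_re, Complex.add_re, Complex.re_ofReal_mul]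
      simp [he, he']
      ring
    linarith
  obtain ⟨α₁, hα₁, hα₁K⟩ := hK.exists_forall_le' hec.continuousOn hegt
  obtain ⟨α₂, hα₂, hα₂K⟩ := hK.exists_forall_le' hec'.continuousOn hegt'
  obtain ⟨β₁, hβ₁⟩ := hK.bddAbove_image hec.continuousOn
  obtain ⟨β₂, hβ₂⟩ := hK.bddAbove_image hec'.continuousOn
  obtain ⟨b, hb⟩ := hK.bddAbove_image hac.continuousOn
  set α := min α₁ α₂
  set β := max α (max β₁ β₂)
  have hα : (m : ℝ) < α := lt_min hα₁ hα₂
  have hβ : (m : ℝ) < β := hα.trans_le (le_max_left _ _)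
  obtain ⟨l, hl0, hl1, hl⟩ := exists_mul_trace_le hτ
  set C := (imPart z).det ^ (-(κ / 2 : ℝ)) * (1 + (⌈b⌉₊).factorial + l ^ (-(⌈b⌉₊ : ℝ)))
  have hc : 0 < Real.pi * l := mul_pos Real.pi_pos hl0
  refine ⟨_, ((summable_exp_neg_trace_mul_det_rpow hm hΓ hR hz hc hα).add
    (summable_exp_neg_trace_mul_det_rpow hm hΓ hR hz hc hβ)).mul_left C, fun γ p hp => ?_⟩
  have hsymp := hΓ.symplectic _ (hR.1 γ.2)
  have hY := hsymp.imPart_act_posDef hz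
  have hT : 0 < (imPart (act (γ : Matrix _ _ ℝ) z)).trace := by
    have := Fin.pos_iff_nonempty.mp (Nat.pos_of_ne_zero hm)
    exact hY.trace_pos
  have ha : |p.1.re| ≤ (⌈b⌉₊ : ℝ) := (hb ⟨p, hp, rfl⟩).trans (Nat.le_ceil b)
  have hαe : α ≤ e p := (min_le_left _ _).trans (hα₁K p hp)
  have hαe' : α ≤ e' p := (min_le_right _ _).trans (hα₂K p hp)
  have hβe : e p ≤ β :=
    ((hβ₁ ⟨p, hp, rfl⟩).trans (le_max_left _ _)).trans (le_max_right _ _)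
  have hβe' : e' p ≤ β :=
    ((hβ₂ ⟨p, hp, rfl⟩).trans (le_max_right _ _)).trans (le_max_right _ _)
  have h := exp_mul_rpow_mul_rpow_le hm hl0 hl1 (hl _ hY) hT hY.det_pos (det_le_trace_pow hY) ha
    hαe hβe hαe' hβe'
  rw [norm_term1 κ p.1 p.2 hsymp hz ((mul_pos hl0 hT).trans_le (hl _ hY))]
  refine (mul_le_mul_of_nonneg_left h (Real.rpow_nonneg hz.2.det_pos.le _)).trans_eq ?_
  simp only [C]
  ring

/-- the Poincaré series `𝒫_τ(z,s₁,s₂)` of weight `κ` converges absolutely,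
uniformly for `(s₁,s₂)` in compact subsets of the region `Re(2s₂+κ) > 2m`,
`Re((2/m)s₁+2s₂+κ) > 2m`.  In particular for `m = 2`, `κ = 4` and the coordinates
`s₁ = (v−2u−1)/2`, `s₂ = (u−2)/2` it converges absolutely on the cone
`A = {Re u > 2, Re v > 5}`. -/
theorem statement1 (m : ℕ) (hm : 1 ≤ m) (κ : ℕ) (hκ : 0 < κ)
    (τ : Matrix (Fin m) (Fin m) ℝ) (hτpos : τ.PosDef) (hτ : HalfIntegral τ)
    (Γ R : Set (Matrix (Fin m ⊕ Fin m) (Fin m ⊕ Fin m) ℝ))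
    (hΓ : IsModularSubgroup m Γ) (hR : IsReps m Γ R)
    (z : Matrix (Fin m) (Fin m) ℂ) (hz : z ∈ SiegelUHS m) :
    (∀ s₁ s₂ : ℂ, (s₁, s₂) ∈ Region1 m κ →
      Summable (fun γ : R => ‖term1 τ κ s₁ s₂ (γ : Matrix _ _ ℝ) z‖)) ∧
    (∀ K : Set (ℂ × ℂ), IsCompact K → K ⊆ Region1 m κ →
      TendstoUniformlyOn
        (fun (t : Finset R) (p : ℂ × ℂ) => ∑ γ ∈ t, term1 τ κ p.1 p.2 (γ : Matrix _ _ ℝ) z)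
        (fun p => ∑' γ : R, term1 τ κ p.1 p.2 (γ : Matrix _ _ ℝ) z)
        Filter.atTop K) ∧
    (m = 2 → κ = 4 → ∀ u v : ℂ, 2 < u.re → 5 < v.re →
      Summable (fun γ : R =>
        ‖term1 τ κ ((v - 2 * u - 1) / 2) ((u - 2) / 2) (γ : Matrix _ _ ℝ) z‖)) := by
  have hm0 : m ≠ 0 := by omega
  have h1 : ∀ s₁ s₂ : ℂ, (s₁, s₂) ∈ Region1 m κ →
      Summable (fun γ : R => ‖term1 τ κ s₁ s₂ (γ : Matrix _ _ ℝ) z‖) := fun s₁ s₂ hs => by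
    obtain ⟨u, hu, hb⟩ := exists_summable_majorant hm0 κ hτpos hΓ hR hz
      (isCompact_singleton (x := (s₁, s₂))) (Set.singleton_subset_iff.mpr hs)
    refine Summable.of_nonneg_of_le (fun _ => norm_nonneg _) (fun γ => ?_) hu
    have h := hb γ (s₁, s₂) (Set.mem_singleton _)
    exact h
  refine ⟨h1, fun K hK hKR => ?_, ?_⟩
  · obtain ⟨u, hu, hb⟩ := exists_summable_majorant hm0 κ hτpos hΓ hR hz hK hKR
    exact tendstoUniformlyOn_tsum hu hb
  · rintro rfl rfl u v hu hv
    refine h1 _ _ ⟨?_, ?_⟩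
    · have h : 2 * ((u - 2) / 2) + ((4 : ℕ) : ℂ) = u + (2 : ℝ) := by push_cast; ring
      rw [h, Complex.add_re, Complex.ofReal_re]
      norm_num
      linarith
    · have h : 2 / ((2 : ℕ) : ℂ) * ((v - 2 * u - 1) / 2) + 2 * ((u - 2) / 2) + ((4 : ℕ) : ℂ)
          = (1 / 2 : ℝ) * v + (3 / 2 : ℝ) := by push_cast; ring
      rw [h, Complex.add_re, Complex.ofReal_re, Complex.re_ofReal_mul]
      norm_num
      linarith
end
end

section
/- For every w ∈ ℌ_m the matrix w + iE_m is invertible; setting ζ = (w − iE_m)(w + iE_m)^{−1} (the Cayley transform of w), the matrix ζ is symmetric, E_m − ζζ̄ is positive definite, and det(E_m − ζζ̄) = 4^m · det(Im w) / |det(w + iE_m)|², where ζ̄ denotes the entrywise complex conjugate of ζ. -/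
open Matrix
open scoped ComplexOrder

noncomputable section

/-- The Cayley transform `ζ = (w − iE)(w + iE)⁻¹`. -/
def cayley {m : ℕ} (w : Matrix (Fin m) (Fin m) ℂ) : Matrix (Fin m) (Fin m) ℂ :=
  (w - Complex.I • 1) * (w + Complex.I • 1)⁻¹

open scoped MatrixOrder in
/-- A positive definite real matrix stays positive definite over the complex numbers. -/
theorem posDef_map_ofReal {n : Type*} [Fintype n] [DecidableEq n] {A : Matrix n n ℝ}
    (hA : A.PosDef) : (A.map Complex.ofRealHom).PosDef := by
  have hpsd : (A.map Complex.ofRealHom).PosSemidef := by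
    obtain ⟨B, rfl⟩ : ∃ B : Matrix n n ℝ, A = Bᴴ * B := by
      obtain ⟨B, hB⟩ := CStarAlgebra.nonneg_iff_eq_star_mul_self.mp hA.posSemidef.nonneg
      exact ⟨B, hB⟩
    have h : (Bᴴ * B).map Complex.ofRealHom =
        (B.map Complex.ofRealHom)ᴴ * B.map Complex.ofRealHom := by
      rw [Matrix.map_mul]
      congr 1
      ext i j
      simp
    rw [h]
    exact posSemidef_conjTranspose_mul_self _
  rw [hpsd.posDef_iff_det_ne_zero]
  have hdet : (A.map Complex.ofRealHom).det = (A.det : ℂ) :=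
    (Complex.ofRealHom.map_det A).symm
  rw [hdet]
  exact_mod_cast hA.det_pos.ne'

theorem Matrix.IsSymm.conjTranspose_eq_sub_imPart {m : ℕ} {w : Matrix (Fin m) (Fin m) ℂ}
    (hw : w.IsSymm) :
    wᴴ = w - (2 * Complex.I) • (imPart w).map Complex.ofRealHom := by
  ext i j
  have h : w j i = w i j := hw.apply i j
  apply Complex.ext <;> simp [imPart, h]
  ring

/-- The identity `(w + i)(w + i)ᴴ - (w - i)(w - i)ᴴ = 4 Im w` for symmetric `w`. -/
theorem Matrix.IsSymm.mul_conjTranspose_sub_mul_conjTranspose {m : ℕ}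
    {w : Matrix (Fin m) (Fin m) ℂ} (hw : w.IsSymm) :
    (w + Complex.I • (1 : Matrix (Fin m) (Fin m) ℂ)) * (w + Complex.I • 1)ᴴ -
      (w - Complex.I • 1) * (w - Complex.I • 1)ᴴ =
      (4 : ℂ) • (imPart w).map Complex.ofRealHom := by
  have h4 : (4 : ℂ) = -(2 * Complex.I * (2 * Complex.I)) := by
    linear_combination 4 * Complex.I_mul_I
  rw [conjTranspose_add, conjTranspose_sub, conjTranspose_smul, conjTranspose_one,
    hw.conjTranspose_eq_sub_imPart, h4]
  generalize (imPart w).map Complex.ofRealHom = y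
  simp only [RCLike.star_def, Complex.conj_I, add_mul, sub_mul, mul_add, mul_sub,
    smul_mul_assoc, mul_smul_comm, one_mul, mul_one, smul_smul, smul_add, smul_sub,
    neg_smul, mul_neg]
  module

/-- for `w` in the Siegel upper half space, `w + iE_m` is invertible, the Cayley
transform `ζ` is symmetric, `E_m − ζζ̄` is positive definite, and
`det(E_m − ζζ̄) = 4^m · det(Im w) / |det(w + iE_m)|²`. -/
theorem statement5 (m : ℕ) (w : Matrix (Fin m) (Fin m) ℂ) (hw : w ∈ SiegelUHS m) :
    IsUnit (w + Complex.I • (1 : Matrix (Fin m) (Fin m) ℂ)) ∧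
    (cayley w).IsSymm ∧
    ((1 : Matrix (Fin m) (Fin m) ℂ) - cayley w * (cayley w).map (starRingEnd ℂ)).PosDef ∧
    ((1 : Matrix (Fin m) (Fin m) ℂ) - cayley w * (cayley w).map (starRingEnd ℂ)).det =
      (((4 : ℝ) ^ m * (imPart w).det /
          Complex.normSq (w + Complex.I • (1 : Matrix (Fin m) (Fin m) ℂ)).det : ℝ) : ℂ) := by
  obtain ⟨hs, hy⟩ := hw
  have key := hs.mul_conjTranspose_sub_mul_conjTranspose
  have hpos : ((4 : ℂ) • (imPart w).map Complex.ofRealHom).PosDef :=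
    (posDef_map_ofReal hy).smul (by norm_num)
  have hdetY : ((imPart w).map Complex.ofRealHom).det = ((imPart w).det : ℂ) :=
    (Complex.ofRealHom.map_det (imPart w)).symm
  have hcomm : Commute (w - Complex.I • (1 : Matrix (Fin m) (Fin m) ℂ)) (w + Complex.I • 1) := by
    simp only [Commute, SemiconjBy, add_mul, sub_mul, mul_add, mul_sub, smul_mul_assoc,
      mul_smul_comm, one_mul, mul_one, smul_add, smul_sub]
    abel
  have hAs : (w + Complex.I • (1 : Matrix (Fin m) (Fin m) ℂ)).IsSymm :=
    hs.add (isSymm_one.smul _)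
  have hBs : (w - Complex.I • (1 : Matrix (Fin m) (Fin m) ℂ)).IsSymm :=
    hs.sub (isSymm_one.smul _)
  unfold cayley
  generalize w + Complex.I • (1 : Matrix (Fin m) (Fin m) ℂ) = A at *
  generalize w - Complex.I • (1 : Matrix (Fin m) (Fin m) ℂ) = B at *
  have hA : IsUnit A := by
    have h : (A * Aᴴ).PosDef := by
      rw [sub_eq_iff_eq_add.mp key]
      exact hpos.add_posSemidef (posSemidef_self_mul_conjTranspose B)
    exact isUnit_of_mul_isUnit_left h.isUnit
  have hdet : IsUnit A.det := (isUnit_iff_isUnit_det A).mp hA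
  have hAB : B * A⁻¹ = A⁻¹ * B := by
    calc B * A⁻¹ = A⁻¹ * (A * B) * A⁻¹ := by rw [nonsing_inv_mul_cancel_left _ _ hdet]
      _ = A⁻¹ * B := by rw [← hcomm.eq, ← mul_assoc, mul_nonsing_inv_cancel_right _ _ hdet]
  have hζ : (B * A⁻¹).IsSymm := by
    rw [IsSymm, transpose_mul, transpose_nonsing_inv, hAs.eq, hBs.eq, hAB]
  have hconj : (B * A⁻¹).map (starRingEnd ℂ) = (A⁻¹ * B)ᴴ := by
    rw [← hAB, conjTranspose, hζ.eq]
    rfl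
  have hmain : 1 - B * A⁻¹ * (B * A⁻¹).map (starRingEnd ℂ) =
      A⁻¹ * ((4 : ℂ) • (imPart w).map Complex.ofRealHom) * (A⁻¹)ᴴ := by
    have h1 : A⁻¹ * (A * Aᴴ) * (A⁻¹)ᴴ = 1 := by
      rw [nonsing_inv_mul_cancel_left _ _ hdet, ← conjTranspose_mul, nonsing_inv_mul _ hdet,
        conjTranspose_one]
    rw [hconj, hAB, ← key, mul_sub, sub_mul, h1, conjTranspose_mul]
    simp only [mul_assoc]
  refine ⟨hA, hζ, ?_, ?_⟩
  · rw [hmain]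
    exact (IsUnit.posDef_star_right_conjugate_iff ((isUnit_nonsing_inv_iff).mpr hA)).mpr hpos
  · rw [hmain, det_mul, det_mul, det_smul, det_conjTranspose, det_nonsing_inv, hdetY,
      Fintype.card_fin, Ring.inverse_eq_inv']
    push_cast
    rw [Complex.normSq_eq_conj_mul_self, star_inv₀, RCLike.star_def]
    field_simp
end
end

section
/- Let τ be a real symmetric positive definite m×m matrix. For every compact subset C ⊂ ℌ_m there exist a real polynomial Q with strictly positive coefficients and a constant c > 0 such that for all w ∈ C and all z = x + iy ∈ ℌ_m whose real part satisfies |x_{jk}| ≤ 1/2 for all entries, one has Q(tr(τy))^{−1} ≤ det(Im w)/|det(z − w̄)|² ≤ c, where w̄ is the entrywise complex conjugate of w. -/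
open Matrix

noncomputable section

/-- The determinant of a complex matrix all of whose eigenvalues have norm at least `r` has norm at
least the corresponding power of `r`. -/
lemma pow_card_le_norm_det {n : Type*} [Fintype n] [DecidableEq n] {M : Matrix n n ℂ} {r : ℝ}
    (hr : 0 ≤ r) (h : ∀ (μ : ℂ) (v : n → ℂ), v ≠ 0 → M *ᵥ v = μ • v → r ≤ ‖μ‖) :
    r ^ Fintype.card n ≤ ‖M.det‖ := by
  have key : ∀ s : Multiset ℂ, (∀ μ ∈ s, r ≤ ‖μ‖) → r ^ Multiset.card s ≤ ‖s.prod‖ := by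
    intro s
    induction s using Multiset.induction_on with
    | empty => simp
    | cons a s ih =>
      intro hs
      rw [Multiset.card_cons, Multiset.prod_cons, norm_mul, pow_succ']
      exact mul_le_mul (hs a (by simp)) (ih fun μ hμ => hs μ (by simp [hμ])) (by positivity)
        (norm_nonneg _)
  have hcard : Multiset.card M.charpoly.roots = Fintype.card n := by
    rw [← (IsAlgClosed.splits M.charpoly).natDegree_eq_card_roots, M.charpoly_natDegree_eq_dim]
  rw [det_eq_prod_roots_charpoly, ← hcard]
  refine key _ fun μ hμ => ?_
  have hroot := (Polynomial.mem_roots'.mp hμ).2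
  rw [Polynomial.IsRoot.def, eval_charpoly, ← exists_mulVec_eq_zero_iff] at hroot
  obtain ⟨v, hv, hv0⟩ := hroot
  refine h μ v hv ?_
  rw [sub_mulVec, sub_eq_zero] at hv0
  simpa [← smul_one_eq_diagonal, smul_mulVec] using hv0.symm

open scoped MatrixOrder in
/-- A real positive semidefinite matrix is a Gram matrix. -/
lemma Matrix.PosSemidef.exists_eq_transpose_mul_self {n : Type*} [Fintype n] [DecidableEq n]
    {A : Matrix n n ℝ} (hA : A.PosSemidef) : ∃ B : Matrix n n ℝ, A = Bᵀ * B := by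
  obtain ⟨B, hB⟩ := CStarAlgebra.nonneg_iff_eq_star_mul_self.mp hA.nonneg
  exact ⟨B, by rw [hB, star_eq_conjTranspose, conjTranspose_eq_transpose_of_trivial]⟩

open scoped ComplexOrder in
lemma Matrix.PosSemidef.map_ofReal {n : Type*} [Fintype n] [DecidableEq n]
    {A : Matrix n n ℝ} (hA : A.PosSemidef) : (A.map ((↑) : ℝ → ℂ)).PosSemidef := by
  obtain ⟨B, rfl⟩ := hA.exists_eq_transpose_mul_self
  have : (Bᵀ * B).map ((↑) : ℝ → ℂ) = (B.map (↑))ᴴ * B.map ((↑) : ℝ → ℂ) := by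
    ext i j
    simp [mul_apply]
  rw [this]
  exact posSemidef_conjTranspose_mul_self _

open scoped ComplexOrder in
/-- If `X` and `Y` are real symmetric and `Y ≥ ε`, then `|det (X + iY)| ≥ ε ^ n`. -/
lemma pow_card_le_norm_det_add_I_smul {n : Type*} [Fintype n] [DecidableEq n]
    {X Y : Matrix n n ℝ} {ε : ℝ} (hε : 0 ≤ ε) (hX : X.IsSymm)
    (hY : (Y - ε • (1 : Matrix n n ℝ)).PosSemidef) :
    ε ^ Fintype.card n ≤
      ‖(X.map ((↑) : ℝ → ℂ) + Complex.I • Y.map ((↑) : ℝ → ℂ)).det‖ := by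
  have hXc : (X.map ((↑) : ℝ → ℂ)).IsHermitian := by
    ext i j
    simp [hX.apply i j]
  have hYc : (Y - ε • (1 : Matrix n n ℝ)).map ((↑) : ℝ → ℂ) =
      Y.map ((↑) : ℝ → ℂ) - (ε : ℂ) • 1 := by
    ext i j
    by_cases hij : i = j <;> simp [hij]
  have hYpos := hY.map_ofReal
  rw [hYc] at hYpos
  refine pow_card_le_norm_det hε fun μ v hv hμ => ?_
  have h1 : (star v ⬝ᵥ X.map ((↑) : ℝ → ℂ) *ᵥ v).im = 0 :=
    hXc.im_star_dotProduct_mulVec_self v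
  have h2 := (Complex.le_def.mp (hYpos.dotProduct_mulVec_nonneg v)).1
  have hpos : 0 < star v ⬝ᵥ v := by simpa using hv
  obtain ⟨hre, him⟩ := Complex.lt_def.mp hpos
  have h3 := congrArg (fun u => (star v ⬝ᵥ u).im) hμ
  simp only [add_mulVec, sub_mulVec, smul_mulVec, one_mulVec, dotProduct_add, dotProduct_sub,
    dotProduct_smul, smul_eq_mul, Complex.add_im, Complex.sub_re, Complex.mul_im, Complex.mul_re,
    Complex.I_re, Complex.I_im, Complex.ofReal_re, Complex.ofReal_im, Complex.zero_re,
    Complex.zero_im, h1, ← him] at h2 h3 hre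
  have h4 : ε ≤ μ.im := by
    refine le_of_mul_le_mul_right ?_ hre
    linarith
  exact h4.trans ((le_abs_self _).trans (Complex.abs_im_le_norm μ))

/-- A compact set of positive definite matrices is bounded below by a positive scalar. -/
lemma IsCompact.exists_sub_smul_one_posSemidef {n : Type*} [Fintype n] [DecidableEq n]
    {S : Set (Matrix n n ℝ)} (hS : IsCompact S) (hpos : ∀ A ∈ S, A.PosDef) :
    ∃ ε : ℝ, 0 < ε ∧ ∀ A ∈ S, (A - ε • (1 : Matrix n n ℝ)).PosSemidef := by
  have hcpt := hS.prod (isCompact_sphere (0 : EuclideanSpace ℝ n) 1)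
  obtain ⟨ε, hε, h⟩ := hcpt.exists_forall_le'
    (f := fun p : Matrix n n ℝ × EuclideanSpace ℝ n => p.2.ofLp ⬝ᵥ p.1 *ᵥ p.2.ofLp) (a := 0)
    (by fun_prop) (by
      rintro ⟨A, x⟩ ⟨hA, hx⟩
      have hx0 : x.ofLp ≠ 0 := by
        rintro h0
        have : x = 0 := by ext i; simp [h0]
        simp [this] at hx
      simpa using (hpos A hA).dotProduct_mulVec_pos hx0)
  refine ⟨ε, hε, fun A hA => .of_dotProduct_mulVec_nonneg
    ((hpos A hA).isHermitian.sub (isHermitian_one.smul (by simp [IsSelfAdjoint]))) fun x => ?_⟩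
  obtain rfl | hx := eq_or_ne x 0
  · simp
  set u : EuclideanSpace ℝ n := WithLp.toLp 2 x with hu
  have hu0 : 0 < ‖u‖ := by simpa [hu] using hx
  have hsq : ‖u‖ ^ 2 = x ⬝ᵥ x := by
    simp [EuclideanSpace.norm_sq_eq, u, dotProduct, ← sq]
  have hmem : (A, ‖u‖⁻¹ • u) ∈ S ×ˢ Metric.sphere (0 : EuclideanSpace ℝ n) 1 :=
    ⟨hA, by simp [norm_smul, hu0.ne']⟩
  have := h _ hmem
  simp only [WithLp.ofLp_smul, hu, mulVec_smul, smul_dotProduct, dotProduct_smul, smul_eq_mul]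
    at this
  simp only [star_trivial, sub_mulVec, smul_mulVec, one_mulVec, dotProduct_sub, dotProduct_smul,
    smul_eq_mul, sub_nonneg, ← hsq]
  rw [← hu] at this
  have h5 := mul_le_mul_of_nonneg_right this (sq_nonneg ‖u‖)
  have h6 : ‖u‖⁻¹ * (‖u‖⁻¹ * (x ⬝ᵥ A *ᵥ x)) * ‖u‖ ^ 2 = x ⬝ᵥ A *ᵥ x := by field_simp
  rwa [h6] at h5

lemma Matrix.PosSemidef.trace_mul_nonneg {n : Type*} [Fintype n] [DecidableEq n]
    {A B : Matrix n n ℝ} (hA : A.PosSemidef) (hB : B.PosSemidef) : 0 ≤ (A * B).trace := by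
  obtain ⟨D, rfl⟩ := hB.exists_eq_transpose_mul_self
  rw [← Matrix.mul_assoc, trace_mul_comm, ← Matrix.mul_assoc]
  simpa using (hA.mul_mul_conjTranspose_same D).trace_nonneg

/-- The entries of a positive semidefinite matrix are bounded by its trace. -/
lemma Matrix.PosSemidef.abs_apply_le_trace {n : Type*} [Fintype n] [DecidableEq n]
    {A : Matrix n n ℝ} (hA : A.PosSemidef) (i j : n) : |A i j| ≤ A.trace := by
  have hdiag : ∀ k, A k k ≤ A.trace := fun k =>
    Finset.single_le_sum (f := fun k => A k k) (fun _ _ => hA.diag_nonneg) (Finset.mem_univ k)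
  have hsymm : A j i = A i j := by simpa using hA.isHermitian.apply i j
  have hp := hA.dotProduct_mulVec_nonneg (Pi.single i 1 + Pi.single j 1)
  have hq := hA.dotProduct_mulVec_nonneg (Pi.single i 1 - Pi.single j 1)
  simp only [star_trivial, mulVec_add, mulVec_sub, add_dotProduct, sub_dotProduct, dotProduct_add,
    dotProduct_sub, mulVec_single_one, single_one_dotProduct, col_apply, hsymm] at hp hq
  rw [abs_le]
  constructor <;> linarith [hdiag i, hdiag j]

/-- for `τ` symmetric positive definite and a compact `C ⊂ ℌ_m` there are a real
polynomial `Q` with strictly positive coefficients and a constant `c > 0` such that for all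
`w ∈ C` and all `z = x + iy ∈ ℌ_m` reduced modulo 1 (`|x_{jk}| ≤ 1/2`),
`Q(tr(τy))⁻¹ ≤ det(Im w)/|det(z − w̄)|² ≤ c`. -/
theorem statement6 (m : ℕ) (hm : 1 ≤ m) (τ : Matrix (Fin m) (Fin m) ℝ) (hτ : τ.PosDef)
    (C : Set (Matrix (Fin m) (Fin m) ℂ)) (hC : C ⊆ SiegelUHS m) (hCcpt : IsCompact C) :
    ∃ Q : Polynomial ℝ, (∀ i ≤ Q.natDegree, 0 < Q.coeff i) ∧
      ∃ c : ℝ, 0 < c ∧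
        ∀ w ∈ C, ∀ z ∈ SiegelUHS m, (∀ j k, |rePart z j k| ≤ 1 / 2) →
          (Q.eval ((τ * imPart z).trace))⁻¹ ≤
              (imPart w).det / Complex.normSq ((z - w.map (starRingEnd ℂ)).det) ∧
            (imPart w).det / Complex.normSq ((z - w.map (starRingEnd ℂ)).det) ≤ c := by
  have hcont : Continuous (imPart (m := m)) := by
    unfold imPart
    fun_prop
  obtain ⟨ε, hε, hεC⟩ := (hCcpt.image hcont).exists_sub_smul_one_posSemidef
    (by rintro _ ⟨w, hw, rfl⟩; exact (hC hw).2)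
  obtain ⟨κ, hκ, hκτ⟩ := (isCompact_singleton (x := τ)).exists_sub_smul_one_posSemidef (by simpa)
  obtain ⟨δ, hδ, hδC⟩ := hCcpt.exists_forall_le' (f := fun w => (imPart w).det) (a := 0)
    (by fun_prop) fun w hw => (hC hw).2.det_pos
  obtain ⟨d, hd⟩ := hCcpt.bddAbove_image (f := fun w => (imPart w).det) (by fun_prop)
  obtain ⟨R, hR⟩ := hCcpt.bddAbove_image (f := fun w => ∑ i, ∑ j, ‖w i j‖) (by fun_prop)
  set L : ℝ := 1 + |R| + κ⁻¹ with hL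
  have hL0 : 0 < L := by positivity
  set D : ℝ := δ⁻¹ * ((m.factorial : ℝ) * L ^ m) ^ 2 with hD
  have hD0 : 0 < D := by positivity
  refine ⟨Polynomial.C D * (1 + Polynomial.X) ^ (2 * m), fun i hi => ?_,
    (|d| + 1) / (ε ^ m) ^ 2, by positivity, fun w hw z hz hx => ?_⟩
  · have hi' : i ≤ 2 * m := hi.trans (by compute_degree)
    rw [Polynomial.coeff_C_mul, Polynomial.coeff_one_add_X_pow]
    have := Nat.choose_pos hi'
    positivity
  have hdet0 : 0 < (imPart w).det := (hC hw).2.det_pos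
  set M := z - w.map (starRingEnd ℂ) with hM
  have hlow : ε ^ m ≤ ‖M.det‖ := by
    have hX : (rePart z - rePart w).IsSymm := by
      ext i j
      have h1 := hz.1.apply i j
      have h2 := (hC hw).1.apply i j
      simp [rePart, h1, h2]
    have hY := hz.2.posSemidef.add (hεC _ ⟨w, hw, rfl⟩)
    rw [← add_sub_assoc] at hY
    have hMeq : M = (rePart z - rePart w).map ((↑) : ℝ → ℂ) +
        Complex.I • (imPart z + imPart w).map ((↑) : ℝ → ℂ) := by
      ext i j
      apply Complex.ext <;> simp [hM, rePart, imPart]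
    simpa [hMeq] using pow_card_le_norm_det_add_I_smul hε.le hX hY
  have hnorm0 : 0 < ‖M.det‖ := lt_of_lt_of_le (by positivity) hlow
  set t := (τ * imPart z).trace with ht
  have htr : (imPart z).trace ≤ κ⁻¹ * t := by
    have := (hκτ τ rfl).trace_mul_nonneg hz.2.posSemidef
    rw [Matrix.sub_mul, trace_sub, smul_mul, Matrix.one_mul, trace_smul, smul_eq_mul, sub_nonneg]
      at this
    rwa [le_inv_mul_iff₀ hκ]
  have htr0 : 0 ≤ (imPart z).trace := hz.2.posSemidef.trace_nonneg
  have ht0 : 0 ≤ t := by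
    have := htr0.trans htr
    exact (mul_nonneg_iff_of_pos_left (inv_pos.mpr hκ)).mp this
  have hentry : ∀ i j, ‖M i j‖ ≤ L * (1 + t) := by
    intro i j
    have h1 : ‖z i j‖ ≤ 1 / 2 + κ⁻¹ * t :=
      (Complex.norm_le_abs_re_add_abs_im _).trans (add_le_add (hx i j)
        ((hz.2.posSemidef.abs_apply_le_trace i j).trans htr))
    have h2 : ‖w i j‖ ≤ |R| := by
      refine le_trans ?_ ((hR ⟨w, hw, rfl⟩).trans (le_abs_self R))
      refine le_trans ?_ (Finset.single_le_sum (f := fun i => ∑ j, ‖w i j‖)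
        (fun _ _ => by positivity) (Finset.mem_univ i))
      exact Finset.single_le_sum (f := fun j => ‖w i j‖) (fun _ _ => by positivity)
        (Finset.mem_univ j)
    have h3 : ‖M i j‖ ≤ ‖z i j‖ + ‖w i j‖ := by
      simpa [hM] using norm_sub_le (z i j) (starRingEnd ℂ (w i j))
    have h4 : 0 ≤ (1 + |R|) * t := by positivity
    have h5 : 0 < κ⁻¹ := by positivity
    rw [hL]
    linarith
  have hup : ‖M.det‖ ≤ (m.factorial : ℝ) * (L * (1 + t)) ^ m := by
    simpa [NormedField.toAbsoluteValue] using
      det_le (abv := NormedField.toAbsoluteValue ℂ) hentry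
  rw [Complex.normSq_eq_norm_sq]
  constructor
  · rw [inv_le_comm₀ (by simp; positivity) (by positivity), inv_div, div_le_iff₀ hdet0]
    calc ‖M.det‖ ^ 2 ≤ ((m.factorial : ℝ) * (L * (1 + t)) ^ m) ^ 2 := by gcongr
      _ = D * (1 + t) ^ (2 * m) * δ := by
        rw [hD, mul_pow L, pow_mul']
        field_simp
      _ ≤ D * (1 + t) ^ (2 * m) * (imPart w).det := by
        gcongr
        exact hδC w hw
      _ = _ := by simp
  · have h1 : (imPart w).det ≤ |d| + 1 := by
      linarith [hd ⟨w, hw, rfl⟩, le_abs_self d]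
    gcongr
end
end
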